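/- arXiv:2409.19876 — 3 statements merged into one kernel-verified Lean document; each statement's English description precedes it below -/
import Mathlib

section
/- Let S be a Polish space with a closed partial order ⪯. For probability measures μ, ν on S, μ is stochastically dominated by ν (∫h dμ ≤ ∫h dν for all bounded increasing Borel measurable h) if and only if τ(μ, ν) = 1, where τ(μ, ν) is the maximum over couplings (X, Y) of (μ, ν) of P{X ⪯ Y}. -/
open MeasureTheory
open scoped ENNReal

/-- A defect form of Hall's theorem for integer supplies and demands: if every set of sources has
neighbourhood demand at least its supply minus `D`, then all but `D` units can be transported
along `R`. -/
theorem exists_nat_transport_plan_of_hall {ι κ : Type*} [Fintype ι] [Fintype κ]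
    (R : ι → κ → Prop) (a : ι → ℕ) (b : κ → ℕ) (D : ℕ)
    (hall : ∀ (I : Finset ι) (J : Finset κ), (∀ i ∈ I, ∀ j, R i j → j ∈ J) →
      ∑ i ∈ I, a i ≤ ∑ j ∈ J, b j + D) :
    ∃ m : ι → κ → ℕ, (∀ i j, m i j ≠ 0 → R i j) ∧ (∀ i, ∑ j, m i j ≤ a i) ∧
      (∀ j, ∑ i, m i j ≤ b j) ∧ ∑ i, a i ≤ ∑ i, ∑ j, m i j + D := by
  classical
  let t : (Σ i, Fin (a i)) → Finset ((Σ j, Fin (b j)) ⊕ Fin D) := fun x =>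
    Finset.univ.filter fun y => Sum.elim (fun z => R x.1 z.1) (fun _ => True) y
  have key : ∀ s : Finset (Σ i, Fin (a i)), s.card ≤ (s.biUnion t).card := by
    intro s
    rcases s.eq_empty_or_nonempty with rfl | ⟨x₀, hx₀⟩
    · simp
    let I : Finset ι := s.image Sigma.fst
    let J : Finset κ := Finset.univ.filter fun j => ∃ i ∈ I, R i j
    have h1 : s.card ≤ ∑ i ∈ I, a i := by
      have : s ⊆ I.sigma fun _ => Finset.univ := fun x hx =>
        Finset.mem_sigma.2 ⟨Finset.mem_image_of_mem _ hx, Finset.mem_univ _⟩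
      simpa [Finset.card_sigma] using Finset.card_le_card this
    have h2 : ∑ j ∈ J, b j + D ≤ (s.biUnion t).card := by
      have : (J.sigma fun j => (Finset.univ : Finset (Fin (b j)))).disjSum
          (Finset.univ : Finset (Fin D)) ⊆ s.biUnion t := by
        rintro (⟨j, l⟩ | d) hy
        · simp only [Finset.inl_mem_disjSum, Finset.mem_sigma, Finset.mem_univ, and_true, J,
            Finset.mem_filter, true_and, I, Finset.mem_image] at hy
          obtain ⟨i, ⟨x, hx, rfl⟩, hR⟩ := hy
          exact Finset.mem_biUnion.2 ⟨x, hx, by simpa [t] using hR⟩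
        · exact Finset.mem_biUnion.2 ⟨x₀, hx₀, by simp [t]⟩
      simpa [Finset.card_sigma] using Finset.card_le_card this
    exact (h1.trans (hall I J fun i hi j hR => Finset.mem_filter.2
      ⟨Finset.mem_univ _, i, hi, hR⟩)).trans h2
  obtain ⟨f, hf, hft⟩ := (Finset.all_card_le_biUnion_card_iff_exists_injective t).1 key
  let m : ι → κ → Finset (Σ i, Fin (a i)) := fun i j =>
    Finset.univ.filter fun x => x.1 = i ∧ ∃ l, f x = Sum.inl ⟨j, l⟩
  have mem_m : ∀ i j x, x ∈ m i j ↔ x.1 = i ∧ ∃ l, f x = Sum.inl ⟨j, l⟩ := fun i j x => by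
    simp only [m, Finset.mem_filter, Finset.mem_univ, true_and]
  have hdis : ∀ i j i' j' x, x ∈ m i j → x ∈ m i' j' → i = i' ∧ j = j' := by
    intro i j i' j' x h h'
    obtain ⟨rfl, l, hl⟩ := (mem_m _ _ _).1 h
    obtain ⟨rfl, l', hl'⟩ := (mem_m _ _ _).1 h'
    rw [hl, Sum.inl.injEq] at hl'
    exact ⟨rfl, congrArg Sigma.fst hl'⟩
  refine ⟨fun i j => (m i j).card, ?_, ?_, ?_, ?_⟩
  · intro i j h
    obtain ⟨x, hx⟩ := Finset.card_ne_zero.1 h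
    obtain ⟨rfl, l, hl⟩ := (mem_m _ _ _).1 hx
    simpa [t, hl] using hft x
  · intro i
    rw [← Finset.card_biUnion fun j _ j' _ hjj => Finset.disjoint_left.2 fun x h h' =>
      hjj (hdis _ _ _ _ x h h').2]
    calc _ ≤ (({i} : Finset ι).sigma fun i => (Finset.univ : Finset (Fin (a i)))).card :=
          Finset.card_le_card fun x hx => by
            obtain ⟨j, -, hx⟩ := Finset.mem_biUnion.1 hx
            simp [((mem_m _ _ _).1 hx).1]
      _ = a i := by simp [Finset.card_sigma]
  · intro j
    rw [← Finset.card_biUnion fun i _ i' _ hii => Finset.disjoint_left.2 fun x h h' =>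
      hii (hdis _ _ _ _ x h h').1]
    calc _ ≤ ((Finset.univ : Finset (Fin (b j))).image
            fun l => (Sum.inl ⟨j, l⟩ : (Σ j, Fin (b j)) ⊕ Fin D)).card :=
          Finset.card_le_card_of_injOn f (fun x hx => by
            obtain ⟨i, -, hx⟩ := Finset.mem_biUnion.1 (Finset.mem_coe.1 hx)
            obtain ⟨-, l, hl⟩ := (mem_m _ _ _).1 hx
            rw [hl]
            exact Finset.mem_coe.2 (Finset.mem_image_of_mem _ (Finset.mem_univ l))) hf.injOn
      _ ≤ b j := Finset.card_image_le.trans (by simp)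
  · let M : Finset (Σ i, Fin (a i)) := Finset.univ.filter fun x => ∃ d, f x = Sum.inr d
    have hM : M.card ≤ D := by
      calc _ ≤ ((Finset.univ : Finset (Fin D)).image
              (Sum.inr : Fin D → (Σ j, Fin (b j)) ⊕ Fin D)).card :=
            Finset.card_le_card_of_injOn f (fun x hx => by
              obtain ⟨d, hd⟩ := (Finset.mem_filter.1 (Finset.mem_coe.1 hx)).2
              rw [hd]
              exact Finset.mem_coe.2 (Finset.mem_image_of_mem _ (Finset.mem_univ d))) hf.injOn
        _ ≤ D := Finset.card_image_le.trans (by simp)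
    calc ∑ i, a i = (Finset.univ : Finset (Σ i, Fin (a i))).card := by
          rw [Finset.card_univ, Fintype.card_sigma]; simp
      _ ≤ ((Finset.univ.biUnion fun i => Finset.univ.biUnion fun j => m i j) ∪ M).card :=
          Finset.card_le_card fun x _ => by
            rcases h : f x with ⟨j, l⟩ | d
            · exact Finset.mem_union_left _ (Finset.mem_biUnion.2 ⟨x.1, Finset.mem_univ _,
                Finset.mem_biUnion.2 ⟨j, Finset.mem_univ _, (mem_m _ _ _).2 ⟨rfl, l, h⟩⟩⟩)
            · exact Finset.mem_union_right _
                (Finset.mem_filter.2 ⟨Finset.mem_univ _, d, h⟩)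
      _ ≤ ∑ i, ∑ j, (m i j).card + D := by
          refine (Finset.card_union_le _ _).trans (add_le_add ?_ hM)
          exact Finset.card_biUnion_le.trans
            (Finset.sum_le_sum fun i _ => Finset.card_biUnion_le)

/-- A defect form of Hall's theorem for real supplies and demands, up to an arbitrarily small
error `ε`. -/
theorem exists_transport_plan_of_hall {ι κ : Type*} [Fintype ι] [Fintype κ]
    (R : ι → κ → Prop) (a : ι → ℝ) (b : κ → ℝ) (ha : ∀ i, 0 ≤ a i) (hb : ∀ j, 0 ≤ b j)
    {c ε : ℝ} (hε : 0 < ε)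
    (hall : ∀ (I : Finset ι) (J : Finset κ), (∀ i ∈ I, ∀ j, R i j → j ∈ J) →
      ∑ i ∈ I, a i ≤ ∑ j ∈ J, b j + c) :
    ∃ w : ι → κ → ℝ, (∀ i j, 0 ≤ w i j) ∧ (∀ i j, w i j ≠ 0 → R i j) ∧
      (∀ i, ∑ j, w i j ≤ a i) ∧ (∀ j, ∑ i, w i j ≤ b j) ∧
      ∑ i, a i - c - ε ≤ ∑ i, ∑ j, w i j := by
  set C : ℝ := Fintype.card ι + Fintype.card κ + 1
  have hCpos : 0 < C := by positivity
  obtain ⟨N, hN⟩ := exists_nat_gt (C / ε)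
  have hNpos : (0 : ℝ) < N := lt_trans (by positivity) hN
  have hNε : C ≤ ε * N := by
    rw [div_lt_iff₀ hε] at hN
    linarith
  let a' : ι → ℕ := fun i => ⌊N * a i⌋₊
  let b' : κ → ℕ := fun j => ⌊N * b j⌋₊
  have ha' : ∀ i, (a' i : ℝ) ≤ N * a i := fun i =>
    Nat.floor_le (mul_nonneg hNpos.le (ha i))
  have hb' : ∀ j, (b' j : ℝ) ≤ N * b j := fun j =>
    Nat.floor_le (mul_nonneg hNpos.le (hb j))
  have ha'' : ∀ i, N * a i ≤ a' i + 1 := fun i => (Nat.lt_floor_add_one _).le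
  have hb'' : ∀ j, N * b j ≤ b' j + 1 := fun j => (Nat.lt_floor_add_one _).le
  obtain ⟨D, hD⟩ : ∃ D : ℕ, D = ⌈N * c⌉₊ + Fintype.card κ := ⟨_, rfl⟩
  have hc0 : 0 ≤ c := by simpa using hall ∅ ∅ (by simp)
  have hDle : (D : ℝ) ≤ N * c + 1 + Fintype.card κ := by
    have := (Nat.ceil_lt_add_one (mul_nonneg hNpos.le hc0)).le
    rw [hD, Nat.cast_add]
    linarith
  obtain ⟨m, hR, hrow, hcol, htot⟩ := exists_nat_transport_plan_of_hall R a' b' D (by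
    intro I J hIJ
    have h4 : (∑ i ∈ I, a' i : ℝ) ≤ ∑ j ∈ J, (b' j : ℝ) + D := by
      calc (∑ i ∈ I, a' i : ℝ) ≤ ∑ i ∈ I, N * a i := Finset.sum_le_sum fun i _ => ha' i
        _ = N * ∑ i ∈ I, a i := by rw [Finset.mul_sum]
        _ ≤ N * (∑ j ∈ J, b j + c) := mul_le_mul_of_nonneg_left (hall I J hIJ) hNpos.le
        _ = ∑ j ∈ J, N * b j + N * c := by rw [mul_add, Finset.mul_sum]
        _ ≤ ∑ j ∈ J, ((b' j : ℝ) + 1) + ⌈N * c⌉₊ :=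
          add_le_add (Finset.sum_le_sum fun j _ => hb'' j) (Nat.le_ceil _)
        _ ≤ ∑ j ∈ J, (b' j : ℝ) + D := by
          rw [Finset.sum_add_distrib, hD]
          have : (J.card : ℝ) ≤ Fintype.card κ := by exact_mod_cast Finset.card_le_univ J
          simp only [Nat.cast_add, Finset.sum_const, nsmul_eq_mul, mul_one]
          linarith
    exact_mod_cast h4)
  refine ⟨fun i j => m i j / N, fun i j => by positivity,
    fun i j h => hR i j fun h0 => h (by simp [h0]), ?_, ?_, ?_⟩
  · intro i
    rw [← Finset.sum_div, div_le_iff₀ hNpos, mul_comm (a i)]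
    exact le_trans (by exact_mod_cast hrow i) (ha' i)
  · intro j
    rw [← Finset.sum_div, div_le_iff₀ hNpos, mul_comm (b j)]
    exact le_trans (by exact_mod_cast hcol j) (hb' j)
  · simp_rw [← Finset.sum_div]
    rw [le_div_iff₀ hNpos]
    have h1 : (∑ i, a' i : ℝ) ≤ ∑ i, ∑ j, (m i j : ℝ) + D := by exact_mod_cast htot
    have h2 : N * ∑ i, a i ≤ ∑ i, (a' i : ℝ) + Fintype.card ι := by
      rw [Finset.mul_sum]
      calc _ ≤ ∑ i, ((a' i : ℝ) + 1) := Finset.sum_le_sum fun i _ => ha'' i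
        _ = _ := by simp [Finset.sum_add_distrib]
    rw [sub_mul, sub_mul]
    linarith

/-- A measure whose marginals are bounded by `μ` and `ν` extends to a coupling of `μ` and `ν`. -/
theorem exists_coupling_ge_of_marginals_le {X Y : Type*} [MeasurableSpace X] [MeasurableSpace Y]
    {μ : Measure X} {ν : Measure Y} [IsProbabilityMeasure μ] [IsProbabilityMeasure ν]
    {σ : Measure (X × Y)} (h₁ : σ.fst ≤ μ) (h₂ : σ.snd ≤ ν) :
    ∃ π : Measure (X × Y), π.fst = μ ∧ π.snd = ν ∧ σ ≤ π := by
  have : IsFiniteMeasure σ.fst := isFiniteMeasure_of_le μ h₁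
  have : IsFiniteMeasure σ.snd := isFiniteMeasure_of_le ν h₂
  have hμ := Measure.sub_add_cancel_of_le h₁
  have hν := Measure.sub_add_cancel_of_le h₂
  have e₁ : (μ - σ.fst) Set.univ = 1 - σ Set.univ := by
    rw [Measure.sub_apply MeasurableSet.univ h₁, measure_univ, Measure.fst_univ]
  have e₂ : (ν - σ.snd) Set.univ = 1 - σ Set.univ := by
    rw [Measure.sub_apply MeasurableSet.univ h₂, measure_univ, Measure.snd_univ]
  set r : ℝ≥0∞ := 1 - σ Set.univ
  have hr : r ≠ ∞ := (tsub_le_self.trans_lt ENNReal.one_lt_top).ne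
  by_cases h0 : r = 0
  · rw [h0, Measure.measure_univ_eq_zero] at e₁ e₂
    rw [e₁, zero_add] at hμ
    rw [e₂, zero_add] at hν
    exact ⟨σ, hμ, hν, le_rfl⟩
  · refine ⟨r⁻¹ • (μ - σ.fst).prod (ν - σ.snd) + σ, ?_, ?_, Measure.le_add_left le_rfl⟩
    · conv_rhs => rw [← hμ]
      rw [Measure.fst_add, Measure.fst, Measure.map_smul, Measure.map_fst_prod, e₂, smul_smul,
        ENNReal.inv_mul_cancel h0 hr, one_smul]
    · conv_rhs => rw [← hν]
      rw [Measure.snd_add, Measure.snd, Measure.map_smul, Measure.map_snd_prod, e₁, smul_smul,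
        ENNReal.inv_mul_cancel h0 hr, one_smul]

theorem smul_cond_le_restrict {X : Type*} [MeasurableSpace X] (μ : Measure X) [IsFiniteMeasure μ]
    {s : Set X} {x : ℝ≥0∞} (hx : x ≤ μ s) : x • ProbabilityTheory.cond μ s ≤ μ.restrict s := by
  rw [ProbabilityTheory.cond, smul_smul]
  refine Measure.le_iff'.2 fun t => ?_
  rw [Measure.smul_apply, smul_eq_mul]
  refine mul_le_of_le_one_left zero_le ?_
  rw [← div_eq_mul_inv]
  exact ENNReal.div_le_of_le_mul (by simpa using hx)

theorem sum_smul_cond_le {X ι : Type*} [MeasurableSpace X] [Fintype ι] {μ : Measure X}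
    [IsFiniteMeasure μ] {A : ι → Set X} (hA : ∀ i, MeasurableSet (A i))
    (dA : Pairwise (Function.onFun Disjoint A)) {u : ι → ℝ≥0∞} (hu : ∀ i, u i ≤ μ (A i)) :
    ∑ i, u i • ProbabilityTheory.cond μ (A i) ≤ μ := by
  calc _ ≤ ∑ i, μ.restrict (A i) := Finset.sum_le_sum fun i _ => smul_cond_le_restrict μ (hu i)
    _ = μ.restrict (⋃ i, A i) := by rw [Measure.restrict_iUnion dA hA, Measure.sum_fintype]
    _ ≤ μ := Measure.restrict_le_self

/-- A transport plan between the cells of two finite families of disjoint sets is realised by a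
coupling. -/
theorem exists_coupling_of_transport_plan {X Y ι κ : Type*} [MeasurableSpace X]
    [MeasurableSpace Y] [Fintype ι] [Fintype κ]
    {μ : Measure X} {ν : Measure Y} [IsProbabilityMeasure μ] [IsProbabilityMeasure ν]
    {A : ι → Set X} {B : κ → Set Y} (hA : ∀ i, MeasurableSet (A i))
    (hB : ∀ j, MeasurableSet (B j)) (dA : Pairwise (Function.onFun Disjoint A))
    (dB : Pairwise (Function.onFun Disjoint B)) (w : ι → κ → ℝ≥0∞)
    (hrow : ∀ i, ∑ j, w i j ≤ μ (A i)) (hcol : ∀ j, ∑ i, w i j ≤ ν (B j))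
    {T : Set (X × Y)} (hT : ∀ i j, w i j ≠ 0 → A i ×ˢ B j ⊆ T) :
    ∃ π : Measure (X × Y), π.fst = μ ∧ π.snd = ν ∧ ∑ i, ∑ j, w i j ≤ π T := by
  let p := fun i => ProbabilityTheory.cond μ (A i)
  let q := fun j => ProbabilityTheory.cond ν (B j)
  let σ : Measure (X × Y) := ∑ i, ∑ j, w i j • (p i).prod (q j)
  have h₁ : σ.fst ≤ μ := by
    refine le_trans ?_ (sum_smul_cond_le hA dA hrow)
    simp only [σ, Measure.fst, ← Measure.mapₗ_apply_of_measurable measurable_fst, map_sum, map_smul]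
    refine Finset.sum_le_sum fun i _ => ?_
    rw [Finset.sum_smul]
    refine Finset.sum_le_sum fun j _ => ?_
    rw [Measure.mapₗ_apply_of_measurable measurable_fst, Measure.map_fst_prod]
    refine Measure.le_iff'.2 fun t => ?_
    simp only [Measure.smul_apply, smul_eq_mul]
    gcongr
    exact mul_le_of_le_one_left zero_le prob_le_one
  have h₂ : σ.snd ≤ ν := by
    refine le_trans ?_ (sum_smul_cond_le hB dB hcol)
    simp only [σ]
    rw [Finset.sum_comm]
    simp only [Measure.snd, ← Measure.mapₗ_apply_of_measurable measurable_snd, map_sum, map_smul]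
    refine Finset.sum_le_sum fun j _ => ?_
    rw [Finset.sum_smul]
    refine Finset.sum_le_sum fun i _ => ?_
    rw [Measure.mapₗ_apply_of_measurable measurable_snd, Measure.map_snd_prod]
    refine Measure.le_iff'.2 fun t => ?_
    simp only [Measure.smul_apply, smul_eq_mul]
    gcongr
    exact mul_le_of_le_one_left zero_le prob_le_one
  obtain ⟨π, hπ₁, hπ₂, hπ⟩ := exists_coupling_ge_of_marginals_le h₁ h₂
  refine ⟨π, hπ₁, hπ₂, le_trans ?_ (hπ T)⟩
  simp only [σ, Measure.finsetSum_apply, Measure.smul_apply, smul_eq_mul]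
  refine Finset.sum_le_sum fun i _ => Finset.sum_le_sum fun j _ => ?_
  by_cases hw : w i j = 0
  · simp [hw]
  have h1 : μ (A i) ≠ 0 := fun h => hw <| le_antisymm
    ((Finset.single_le_sum (fun _ _ => zero_le) (Finset.mem_univ j)).trans
      ((hrow i).trans h.le)) zero_le
  have h2 : ν (B j) ≠ 0 := fun h => hw <| le_antisymm
    ((Finset.single_le_sum (f := fun i => w i j) (fun _ _ => zero_le) (Finset.mem_univ i)).trans
      ((hcol j).trans h.le)) zero_le
  have : (p i).prod (q j) (A i ×ˢ B j) = 1 := by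
    rw [Measure.prod_prod, ProbabilityTheory.cond_apply_self h1 (measure_ne_top _ _),
      ProbabilityTheory.cond_apply_self h2 (measure_ne_top _ _), one_mul]
  calc w i j = w i j * (p i).prod (q j) (A i ×ˢ B j) := by rw [this, mul_one]
    _ ≤ _ := by gcongr; exact hT i j hw

theorem IsCompact.isClosed_upperClosure_of_isClosed_le {S : Type*} [TopologicalSpace S] [Preorder S]
    (hcl : IsClosed {p : S × S | p.1 ≤ p.2}) {K : Set S} (hK : IsCompact K) :
    IsClosed (upperClosure K : Set S) := by
  have : CompactSpace K := isCompact_iff_compactSpace.1 hK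
  have hc : IsClosed {p : K × S | (p.1 : S) ≤ p.2} :=
    hcl.preimage ((continuous_subtype_val.comp continuous_fst).prodMk continuous_snd)
  convert isClosedMap_snd_of_compactSpace _ hc using 1
  ext y
  simp [mem_upperClosure]

theorem measure_le_of_upperClosure_subset {S : Type*} [TopologicalSpace S] [PolishSpace S]
    [MeasurableSpace S] [BorelSpace S] [Preorder S] (hcl : IsClosed {p : S × S | p.1 ≤ p.2})
    {μ ν : Measure S} [IsFiniteMeasure μ]
    (hle : ∀ U : Set S, IsUpperSet U → MeasurableSet U → μ U ≤ ν U)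
    {A B : Set S} (hA : MeasurableSet A) (hAB : (upperClosure A : Set S) ⊆ B) : μ A ≤ ν B := by
  refine le_of_forall_lt fun r hr => ?_
  obtain ⟨K, hKA, ⟨hK, -⟩, hrK⟩ :=
    innerRegular_isCompact_isClosed_measurableSet_of_finite μ hA r hr
  calc r < μ K := hrK
    _ ≤ μ (upperClosure K) := measure_mono subset_upperClosure
    _ ≤ ν (upperClosure K) :=
      hle _ (upperClosure K).upper (hK.isClosed_upperClosure_of_isClosed_le hcl).measurableSet
    _ ≤ ν B := measure_mono (Set.Subset.trans (upperClosure_anti hKA) hAB)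

/-- Under stochastic domination there is a coupling almost concentrated near the graph of `≤`. -/
theorem exists_coupling_cthickening {S : Type*} [MetricSpace S] [PolishSpace S]
    [MeasurableSpace S] [BorelSpace S] [Preorder S] (hcl : IsClosed {p : S × S | p.1 ≤ p.2})
    {μ ν : Measure S} [IsProbabilityMeasure μ] [IsProbabilityMeasure ν]
    (hle : ∀ U : Set S, IsUpperSet U → MeasurableSet U → μ U ≤ ν U) {δ : ℝ} (hδ : 0 < δ) :
    ∃ π : Measure (S × S), π.fst = μ ∧ π.snd = ν ∧
      ENNReal.ofReal (1 - δ) ≤ π (Metric.cthickening δ {p : S × S | p.1 ≤ p.2}) := by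
  obtain ⟨A, hAm, hAb, hAd, hAU, hAdis⟩ := SeparableSpace.exists_measurable_partition_diam_le S hδ
  have tail : ∀ ρ : Measure S, IsProbabilityMeasure ρ →
      ∀ᶠ n in Filter.atTop, ρ (⋃ i ∈ Set.Ici n, A i) < ENNReal.ofReal (δ / 4) := by
    intro ρ _
    have := tendsto_measure_biUnion_Ici_zero_of_pairwise_disjoint (μ := ρ)
      (fun n => (hAm n).nullMeasurableSet) hAdis
    exact this.eventually_lt_const (by simpa using by positivity)
  obtain ⟨N, hNμ, hNν⟩ := ((tail μ inferInstance).and (tail ν inferInstance)).exists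
  set E : Set S := ⋃ i ∈ Set.Ici N, A i
  have hNμ' : μ.real E ≤ δ / 4 := ENNReal.toReal_le_of_le_ofReal (by positivity) hNμ.le
  have hNν' : ν.real E ≤ δ / 4 := ENNReal.toReal_le_of_le_ofReal (by positivity) hNν.le
  let B : Fin N → Set S := fun i => A i
  have hBm : ∀ i, MeasurableSet (B i) := fun i => hAm i
  have hBdis : Pairwise (Function.onFun Disjoint B) := fun i j hij =>
    hAdis fun h => hij (Fin.ext h)
  have hsum : ∀ (ρ : Measure S) [IsProbabilityMeasure ρ] (I : Finset (Fin N)),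
      ∑ i ∈ I, ρ.real (B i) = ρ.real (⋃ i ∈ I, B i) := fun ρ _ I =>
    (measureReal_biUnion_finset (fun i _ j _ hij => hBdis hij) fun i _ => hBm i).symm
  have hcover : ∀ x, x ∉ E → ∃ i, x ∈ B i := by
    intro x hx
    obtain ⟨i, hi⟩ := Set.mem_iUnion.1 (hAU ▸ Set.mem_univ x)
    refine ⟨⟨i, not_le.1 fun h => hx ?_⟩, hi⟩
    exact Set.mem_biUnion (Set.mem_Ici.2 h) hi
  obtain ⟨w, hw0, hwR, hrow, hcol, htot⟩ := exists_transport_plan_of_hall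
    (fun i j => ∃ x ∈ B i, ∃ y ∈ B j, x ≤ y) (fun i => μ.real (B i)) (fun j => ν.real (B j))
    (fun _ => measureReal_nonneg) (fun _ => measureReal_nonneg) (c := ν.real E)
    (half_pos hδ) (by
      intro I J hIJ
      rw [hsum μ, hsum ν]
      refine le_trans ?_ (measureReal_union_le _ _)
      refine ENNReal.toReal_mono (measure_ne_top _ _)
        (measure_le_of_upperClosure_subset hcl hle (I.measurableSet_biUnion fun i _ => hBm i) ?_)
      intro y hy
      obtain ⟨x, hx, hxy⟩ := mem_upperClosure.1 hy
      obtain ⟨i, hi, hx⟩ := Set.mem_iUnion₂.1 hx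
      by_cases hyE : y ∈ E
      · exact Or.inr hyE
      · obtain ⟨j, hj⟩ := hcover y hyE
        exact Or.inl (Set.mem_biUnion (hIJ i hi j ⟨x, hx, y, hj, hxy⟩) hj))
  obtain ⟨π, h₁, h₂, h⟩ := exists_coupling_of_transport_plan (μ := μ) (ν := ν) hBm hBm hBdis hBdis
    (fun i j => ENNReal.ofReal (w i j))
    (T := Metric.cthickening δ {p : S × S | p.1 ≤ p.2})
    (fun i => by
      rw [← ENNReal.ofReal_sum_of_nonneg fun j _ => hw0 i j]
      exact ENNReal.ofReal_le_of_le_toReal (hrow i))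
    (fun j => by
      rw [← ENNReal.ofReal_sum_of_nonneg fun i _ => hw0 i j]
      exact ENNReal.ofReal_le_of_le_toReal (hcol j))
    (fun i j hij => by
      obtain ⟨x, hx, y, hy, hxy⟩ := hwR i j fun h => hij (by simp [h])
      rintro ⟨x', y'⟩ ⟨hx', hy'⟩
      refine Metric.mem_cthickening_of_dist_le _ (x, y) _ _ hxy ?_
      exact max_le ((Metric.dist_le_diam_of_mem (hAb _) hx' hx).trans (hAd _))
        ((Metric.dist_le_diam_of_mem (hAb _) hy' hy).trans (hAd _)))
  refine ⟨π, h₁, h₂, le_trans ?_ h⟩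
  simp_rw [← ENNReal.ofReal_sum_of_nonneg fun j (_ : j ∈ Finset.univ) => hw0 _ j]
  rw [← ENNReal.ofReal_sum_of_nonneg fun i _ => Finset.sum_nonneg fun j _ => hw0 i j]
  refine ENNReal.ofReal_le_ofReal (le_trans ?_ htot)
  have hE : 1 ≤ ∑ i, μ.real (B i) + μ.real E := by
    rw [hsum μ]
    refine le_trans (le_of_eq ?_) (measureReal_union_le _ _)
    rw [← probReal_univ (μ := μ)]
    congr 1
    refine (Set.eq_univ_of_forall fun x => ?_).symm
    by_cases hx : x ∈ E
    · exact Or.inr hx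
    · obtain ⟨i, hi⟩ := hcover x hx
      exact Or.inl (Set.mem_biUnion (Finset.mem_univ i) hi)
  linarith

/-- The set of couplings of two probability measures on Polish spaces is weakly compact. -/
theorem isCompact_setOf_couplings {X Y : Type*} [TopologicalSpace X] [PolishSpace X]
    [MeasurableSpace X] [BorelSpace X] [TopologicalSpace Y] [PolishSpace Y] [MeasurableSpace Y]
    [BorelSpace Y] (μ : Measure X) (ν : Measure Y) [IsProbabilityMeasure μ]
    [IsProbabilityMeasure ν] :
    IsCompact {π : ProbabilityMeasure (X × Y) |
      (π : Measure (X × Y)).fst = μ ∧ (π : Measure (X × Y)).snd = ν} := by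
  set C := {π : ProbabilityMeasure (X × Y) |
      (π : Measure (X × Y)).fst = μ ∧ (π : Measure (X × Y)).snd = ν} with hC
  have hclosed : IsClosed C := by
    have : C = (fun π => π.map measurable_fst.aemeasurable) ⁻¹' {(⟨μ, ‹_›⟩ : ProbabilityMeasure X)}
        ∩ (fun π => π.map measurable_snd.aemeasurable) ⁻¹'
          {(⟨ν, ‹_›⟩ : ProbabilityMeasure Y)} := by
      ext π
      exact ⟨fun h => ⟨Subtype.ext h.1, Subtype.ext h.2⟩,
        fun h => ⟨congrArg Subtype.val h.1, congrArg Subtype.val h.2⟩⟩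
    rw [this]
    exact (isClosed_singleton.preimage (ProbabilityMeasure.continuous_map continuous_fst)).inter
      (isClosed_singleton.preimage (ProbabilityMeasure.continuous_map continuous_snd))
  rw [← hclosed.closure_eq]
  refine isCompact_closure_of_isTightMeasureSet (IsTightMeasureSet.prodMk ?_ ?_)
  · refine (isTightMeasureSet_singleton (μ := μ)).subset ?_
    rintro _ ⟨_, ⟨π, hπ, rfl⟩, rfl⟩
    exact hπ.1
  · refine (isTightMeasureSet_singleton (μ := ν)).subset ?_
    rintro _ ⟨_, ⟨π, hπ, rfl⟩, rfl⟩
    exact hπ.2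

/-- **Strassen's theorem**: stochastic domination yields a monotone coupling. -/
theorem exists_coupling_le {S : Type*} [TopologicalSpace S] [PolishSpace S]
    [MeasurableSpace S] [BorelSpace S] [Preorder S] (hcl : IsClosed {p : S × S | p.1 ≤ p.2})
    {μ ν : Measure S} [IsProbabilityMeasure μ] [IsProbabilityMeasure ν]
    (hle : ∀ U : Set S, IsUpperSet U → MeasurableSet U → μ U ≤ ν U) :
    ∃ π : Measure (S × S), π.fst = μ ∧ π.snd = ν ∧ π {p : S × S | p.1 ≤ p.2} = 1 := by
  let _ := TopologicalSpace.upgradeIsCompletelyMetrizable S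
  set T := {p : S × S | p.1 ≤ p.2}
  have hpos : ∀ n : ℕ, (0 : ℝ) < 1 / (n + 1) := fun n => Nat.one_div_pos_of_nat
  choose π h₁ h₂ h using fun n : ℕ => exists_coupling_cthickening hcl hle (hpos n)
  have hprob : ∀ n, IsProbabilityMeasure (π n) := fun n =>
    ⟨by rw [← Measure.fst_univ, h₁, measure_univ]⟩
  let P : ℕ → ProbabilityMeasure (S × S) := fun n => ⟨π n, hprob n⟩
  let F : Ultrafilter ℕ := Filter.hyperfilter ℕ
  have hF : (F : Filter ℕ) ≤ Filter.atTop := Nat.hyperfilter_le_atTop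
  obtain ⟨Q, hQ, hlim⟩ := (isCompact_setOf_couplings μ ν).ultrafilter_le_nhds (F.map P)
    (Filter.le_principal_iff.2 (Ultrafilter.mem_map.2 (Filter.univ_mem' fun n => ⟨h₁ n, h₂ n⟩)))
  have hlim : Filter.Tendsto P F (nhds Q) := hlim
  refine ⟨Q, hQ.1, hQ.2, le_antisymm prob_le_one ?_⟩
  have hthick : ∀ δ > 0, (Q : Measure (S × S)) (Metric.cthickening δ T) = 1 := by
    intro δ hδ
    refine le_antisymm prob_le_one ?_
    refine le_trans ?_ (ProbabilityMeasure.limsup_measure_closed_le_of_tendsto hlim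
      Metric.isClosed_cthickening)
    have ht : Filter.Tendsto (fun n : ℕ => ENNReal.ofReal (1 - 1 / ((n : ℝ) + 1))) F (nhds 1) := by
      have := ENNReal.tendsto_ofReal
        ((tendsto_const_nhds (x := (1 : ℝ))).sub tendsto_one_div_add_atTop_nhds_zero_nat)
      simp only [sub_zero, ENNReal.ofReal_one] at this
      exact this.mono_left hF
    rw [← ht.limsup_eq]
    refine Filter.limsup_le_limsup ?_
    have hev : ∀ᶠ n : ℕ in Filter.atTop, 1 / ((n : ℝ) + 1) < δ :=
      tendsto_one_div_add_atTop_nhds_zero_nat.eventually_lt_const hδ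
    filter_upwards [hF hev] with n hn
    exact (h n).trans (measure_mono (Metric.cthickening_mono (le_of_lt hn) _))
  have hT := tendsto_measure_cthickening_of_isClosed (μ := (Q : Measure (S × S))) (s := T)
    ⟨1, one_pos, measure_ne_top _ _⟩ hcl
  refine ge_of_tendsto (hT.mono_left (nhdsWithin_le_nhds (s := Set.Ioi 0))) ?_
  filter_upwards [self_mem_nhdsWithin] with δ hδ using (hthick δ hδ).ge

theorem integral_le_integral_add_of_coupling {S : Type*} [MeasurableSpace S] [Preorder S]
    {π : Measure (S × S)} [IsProbabilityMeasure π]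
    (hm : MeasurableSet {p : S × S | p.1 ≤ p.2}) {f : S → ℝ} (hf : Measurable f)
    (hmono : Monotone f) {C : ℝ} (hC : ∀ x, |f x| ≤ C) :
    ∫ x, f x ∂π.fst ≤ ∫ x, f x ∂π.snd + 2 * C * (1 - π.real {p : S × S | p.1 ≤ p.2}) := by
  have hi : ∀ g : S × S → S, Measurable g → Integrable (fun p => f (g p)) π := fun g hg =>
    Integrable.of_bound (hf.comp hg).aestronglyMeasurable C
      (Filter.Eventually.of_forall fun p => hC _)
  have hind : Integrable ({p : S × S | p.1 ≤ p.2}ᶜ.indicator fun _ => 2 * C) π :=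
    (integrable_const _).indicator hm.compl
  rw [Measure.fst, Measure.snd, integral_map measurable_fst.aemeasurable hf.aestronglyMeasurable,
    integral_map measurable_snd.aemeasurable hf.aestronglyMeasurable, ← probReal_compl_eq_one_sub hm,
    mul_comm (2 * C), ← smul_eq_mul, ← integral_indicator_const _ hm.compl,
    ← integral_add (hi _ measurable_snd) hind]
  refine integral_mono (hi _ measurable_fst) ((hi _ measurable_snd).add hind) fun p => ?_
  by_cases hp : p.1 ≤ p.2
  · simpa [hp] using hmono hp
  · have h1 := (abs_le.1 (hC p.1)).2
    have h2 := (abs_le.1 (hC p.2)).1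
    simp only [Set.mem_compl_iff, Set.mem_ofPred_eq, hp, not_false_eq_true,
      Set.indicator_of_mem]
    linarith

/-- Strassen's theorem: on a Polish space with a closed partial order, `μ` is stochastically
dominated by `ν` (all bounded increasing Borel functions have larger integral under `ν`)
if and only if `τ(μ, ν) = 1`, where `τ(μ, ν)` is the maximal probability of `X ⪯ Y`
over couplings `(X, Y)` of `(μ, ν)`. -/
theorem strassen_sd_iff_tau_eq_one {S : Type*} [TopologicalSpace S] [PolishSpace S]
    [MeasurableSpace S] [BorelSpace S] [PartialOrder S]
    (hcl : IsClosed {p : S × S | p.1 ≤ p.2})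
    (μ ν : Measure S) [IsProbabilityMeasure μ] [IsProbabilityMeasure ν] :
    (∀ h : S → ℝ, Measurable h → Monotone h → (∃ C, ∀ x, |h x| ≤ C) →
        ∫ x, h x ∂μ ≤ ∫ x, h x ∂ν) ↔
    (⨆ (π : Measure (S × S)) (_ : π.map Prod.fst = μ ∧ π.map Prod.snd = ν),
        π {p : S × S | p.1 ≤ p.2}) = 1 := by
  constructor
  · intro h
    have hle : ∀ U : Set S, IsUpperSet U → MeasurableSet U → μ U ≤ ν U := by
      intro U hU hm
      have := h (U.indicator 1) (measurable_one.indicator hm)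
        (fun x y hxy => by
          by_cases hx : x ∈ U
          · simp [hx, hU hxy hx]
          · rw [Set.indicator_of_notMem hx]
            exact Set.indicator_nonneg (fun _ _ => zero_le_one) y)
        ⟨1, fun x => by by_cases hx : x ∈ U <;> simp [hx]⟩
      rw [integral_indicator_one hm, integral_indicator_one hm] at this
      exact (ENNReal.toReal_le_toReal (measure_ne_top _ _) (measure_ne_top _ _)).1 this
    obtain ⟨π, h₁, h₂, hπ⟩ := exists_coupling_le hcl hle
    refine le_antisymm (iSup₂_le fun ρ hρ => ?_) (hπ ▸ le_iSup₂ (f := fun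
      (π : Measure (S × S)) (_ : π.map Prod.fst = μ ∧ π.map Prod.snd = ν) =>
        π {p : S × S | p.1 ≤ p.2}) π ⟨h₁, h₂⟩)
    calc ρ _ ≤ ρ Set.univ := measure_mono (Set.subset_univ _)
      _ = 1 := by rw [← Measure.fst_univ, Measure.fst, hρ.1, measure_univ]
  · rintro h f hf hmono ⟨C, hC⟩
    have hC0 : 0 ≤ C := by
      obtain ⟨x⟩ := nonempty_of_isProbabilityMeasure μ
      exact (abs_nonneg _).trans (hC x)
    refine le_of_forall_pos_le_add fun ε hε => ?_
    have hlt : ENNReal.ofReal (1 - ε / (2 * C + 1)) < 1 := by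
      rw [← ENNReal.ofReal_one, ENNReal.ofReal_lt_ofReal_iff one_pos]
      have : 0 < ε / (2 * C + 1) := by positivity
      linarith
    rw [← h] at hlt
    obtain ⟨π, hlt⟩ := lt_iSup_iff.1 hlt
    obtain ⟨⟨h₁, h₂⟩, hlt⟩ := lt_iSup_iff.1 hlt
    have : IsProbabilityMeasure π := ⟨by rw [← Measure.fst_univ, Measure.fst, h₁, measure_univ]⟩
    have key := integral_le_integral_add_of_coupling (π := π) hcl.measurableSet hf hmono hC
    rw [Measure.fst, Measure.snd, h₁, h₂] at key
    refine key.trans (add_le_add le_rfl ?_)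
    have hge : 1 - ε / (2 * C + 1) ≤ π.real {p : S × S | p.1 ≤ p.2} :=
      (ENNReal.ofReal_le_iff_le_toReal (measure_ne_top _ _)).1 hlt.le
    calc _ ≤ (2 * C + 1) * (ε / (2 * C + 1)) :=
          mul_le_mul (by linarith) (by linarith) (sub_nonneg.2 measureReal_le_one) (by linarith)
      _ = ε := by field_simp
end

section
/- Let S be a Polish space with closed partial order ⪯ and probability measures μ, ν. Then τ(μ, ν) = 1 − max over decreasing Borel functions g with osc(g) ≤ 1 of (∫g dν − ∫g dμ), equivalently τ(μ, ν) = 1 − max over increasing Borel functions h with osc(h) ≤ 1 of (∫h dμ − ∫h dν). -/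
open MeasureTheory

/-- A positive linear functional on the continuous functions on a compact Hausdorff space is
integration against a finite measure. -/
lemma exists_measure_integral_eq_of_nonneg {X : Type*} [TopologicalSpace X] [CompactSpace X]
    [T2Space X] [MeasurableSpace X] [BorelSpace X] (L : C(X, ℝ) →ₗ[ℝ] ℝ)
    (hL : ∀ f : C(X, ℝ), (∀ x, 0 ≤ f x) → 0 ≤ L f) :
    ∃ π : Measure X, IsFiniteMeasure π ∧ ∀ f : C(X, ℝ), ∫ x, f x ∂π = L f := by
  let Λ : CompactlySupportedContinuousMap X ℝ →ₚ[ℝ] ℝ :=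
    { toFun := fun g => L g.toContinuousMap
      map_add' := fun g g' => map_add L g.toContinuousMap g'.toContinuousMap
      map_smul' := fun c g => map_smul L c g.toContinuousMap
      monotone' := fun g g' hgg' => by
        have h := hL (g'.toContinuousMap - g.toContinuousMap) fun x => sub_nonneg.2 (hgg' x)
        rw [map_sub] at h
        exact sub_nonneg.1 h }
  exact ⟨RealRMK.rieszMeasure Λ, inferInstance, fun f =>
    RealRMK.integral_rieszMeasure Λ (CompactlySupportedContinuousMap.continuousMapEquiv f)⟩

/-- If every continuous function above the indicator of a closed set has integral at least `P`,
then the set has measure at least `P`. -/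
lemma le_measureReal_of_forall_le_integral {X : Type*} [TopologicalSpace X]
    [HasOuterApproxClosed X] [MeasurableSpace X] [BorelSpace X]
    (π : Measure X) [IsFiniteMeasure π] {F : Set X} (hF : IsClosed F) {P : ℝ}
    (h : ∀ f : C(X, ℝ), (∀ x, 0 ≤ f x) → (∀ x ∈ F, 1 ≤ f x) → P ≤ ∫ x, f x ∂π) :
    P ≤ π.real F := by
  have hlim := (ENNReal.tendsto_toReal (measure_ne_top π F)).comp
    (HasOuterApproxClosed.tendsto_lintegral_apprSeq hF π)
  refine ge_of_tendsto' hlim fun n => ?_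
  let f : C(X, ℝ) := ⟨fun x => (hF.apprSeq n x : ℝ), by fun_prop⟩
  have hf := h f (fun x => (hF.apprSeq n x).2) fun x hx => by
    simp [f, HasOuterApproxClosed.apprSeq_apply_eq_one hF n hx]
  refine hf.trans_eq ?_
  rw [integral_eq_lintegral_of_nonneg_ae (f := f) (.of_forall fun x => (hF.apprSeq n x).2)
    f.continuous.aestronglyMeasurable]
  simp [f]

/-- Kantorovich duality on a compact metrizable space: if every pair of continuous potentials
dominating the indicator of a closed relation `F` has cost at least `P`, then some coupling gives
`F` mass at least `P`. -/
lemma exists_coupling_le_measureReal_of_compactSpace {X : Type*} [TopologicalSpace X]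
    [CompactSpace X] [TopologicalSpace.MetrizableSpace X] [SecondCountableTopology X]
    [MeasurableSpace X] [BorelSpace X]
    (μ ν : Measure X) [IsProbabilityMeasure μ] [IsProbabilityMeasure ν]
    {F : Set (X × X)} (hF : IsClosed F) {P : ℝ}
    (hP : ∀ φ ψ : C(X, ℝ), (∀ x y, 0 ≤ φ x + ψ y) → (∀ p ∈ F, 1 ≤ φ p.1 + ψ p.2) →
      P ≤ ∫ x, φ x ∂μ + ∫ y, ψ y ∂ν) :
    ∃ π : Measure (X × X), π.map Prod.fst = μ ∧ π.map Prod.snd = ν ∧ P ≤ π.real F := by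
  have hint : ∀ (m : Measure X) [IsProbabilityMeasure m] (f : C(X, ℝ)), Integrable f m :=
    fun m _ f => (BoundedContinuousFunction.mkOfCompact f).integrable m
  have hint' : ∀ f : C(X × X, ℝ), Integrable f (μ.prod ν) :=
    fun f => (BoundedContinuousFunction.mkOfCompact f).integrable _
  let pr : C(X, ℝ) → C(X, ℝ) → C(X × X, ℝ) := fun φ ψ =>
    φ.comp ⟨Prod.fst, continuous_fst⟩ + ψ.comp ⟨Prod.snd, continuous_snd⟩
  have hpr : ∀ φ ψ p, pr φ ψ p = φ p.1 + ψ p.2 := fun _ _ _ => rfl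
  have hIpr : ∀ φ ψ, ∫ p, pr φ ψ p ∂(μ.prod ν) = ∫ x, φ x ∂μ + ∫ y, ψ y ∂ν := fun φ ψ => by
    simp_rw [hpr]
    rw [integral_add ((hint μ φ).comp_fst ν) ((hint ν ψ).comp_snd μ), integral_fun_fst,
      integral_fun_snd]
    simp
  let I : C(X × X, ℝ) →ₗ[ℝ] ℝ :=
    { toFun := fun f => ∫ p, f p ∂(μ.prod ν)
      map_add' := fun f g => integral_add (hint' f) (hint' g)
      map_smul' := fun c f => integral_const_mul c f }
  let V : Submodule ℝ C(X × X, ℝ) :=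
    { carrier := {f | ∃ φ ψ, pr φ ψ = f}
      add_mem' := by
        rintro _ _ ⟨φ, ψ, rfl⟩ ⟨φ', ψ', rfl⟩
        exact ⟨φ + φ', ψ + ψ', by ext p; simp [hpr]; ring⟩
      zero_mem' := ⟨0, 0, by ext p; simp [hpr]⟩
      smul_mem' := by
        rintro c _ ⟨φ, ψ, rfl⟩
        exact ⟨c • φ, c • ψ, by ext p; simp [hpr]; ring⟩ }
  let s : PointedCone ℝ C(X × X, ℝ) :=
    { carrier := {f | ∃ c : ℝ, 0 ≤ c ∧ (∀ p, -(c * P) ≤ f p) ∧ ∀ p ∈ F, c * (1 - P) ≤ f p}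
      add_mem' := by
        rintro f g ⟨c, hc, hf, hf'⟩ ⟨d, hd, hg, hg'⟩
        refine ⟨c + d, add_nonneg hc hd, fun p => ?_, fun p hp => ?_⟩
        · have := hf p; have := hg p; simp only [ContinuousMap.add_apply]; linarith
        · have := hf' p hp; have := hg' p hp; simp only [ContinuousMap.add_apply]; linarith
      zero_mem' := ⟨0, le_rfl, by simp, by simp⟩
      smul_mem' := by
        rintro ⟨a, ha⟩ f ⟨c, hc, hf, hf'⟩
        refine ⟨a * c, mul_nonneg ha hc, fun p => ?_, fun p hp => ?_⟩
        · have := mul_le_mul_of_nonneg_left (hf p) ha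
          change _ ≤ a * f p
          linarith
        · have := mul_le_mul_of_nonneg_left (hf' p hp) ha
          change _ ≤ a * f p
          linarith }
  have hpos : ∀ f : C(X × X, ℝ), f ∈ V → f ∈ s → 0 ≤ I f := by
    rintro _ ⟨φ, ψ, rfl⟩ ⟨c, hc, h1, h2⟩
    rcases hc.eq_or_lt with rfl | hc
    · exact integral_nonneg fun p => by simpa using h1 p
    · have key := hP (c⁻¹ • φ + ContinuousMap.const X P) (c⁻¹ • ψ) (fun x y => ?_)
        (fun p hp => ?_)
      · have e1 : ∫ x, (c⁻¹ • φ + ContinuousMap.const X P) x ∂μ = c⁻¹ * ∫ x, φ x ∂μ + P := by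
          simp only [ContinuousMap.add_apply, ContinuousMap.smul_apply, smul_eq_mul,
            ContinuousMap.const_apply]
          rw [integral_add ((hint μ φ).const_mul _) (integrable_const _), integral_const_mul]
          simp
        have e2 : ∫ x, (c⁻¹ • ψ) x ∂ν = c⁻¹ * ∫ x, ψ x ∂ν := by
          simp only [ContinuousMap.smul_apply, smul_eq_mul]
          rw [integral_const_mul]
        rw [e1, e2] at key
        change 0 ≤ ∫ p, pr φ ψ p ∂(μ.prod ν)
        rw [hIpr]
        have : 0 ≤ c⁻¹ * (∫ x, φ x ∂μ + ∫ y, ψ y ∂ν) := by linarith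
        exact nonneg_of_mul_nonneg_right this (inv_pos.2 hc)
      · have := mul_le_mul_of_nonneg_left (h1 (x, y)) (inv_pos.2 hc).le
        rw [hpr, mul_neg, inv_mul_cancel_left₀ hc.ne'] at this
        simp only [ContinuousMap.add_apply, ContinuousMap.smul_apply, smul_eq_mul,
            ContinuousMap.const_apply]
        linarith
      · have := mul_le_mul_of_nonneg_left (h2 p hp) (inv_pos.2 hc).le
        rw [hpr, inv_mul_cancel_left₀ hc.ne'] at this
        simp only [ContinuousMap.add_apply, ContinuousMap.smul_apply, smul_eq_mul,
            ContinuousMap.const_apply]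
        linarith
  obtain ⟨L, hLV, hLs⟩ := riesz_extension s ⟨V, I.comp V.subtype⟩
    (fun f hf => hpos f f.2 hf) (fun f => by
      refine ⟨⟨pr (ContinuousMap.const X ‖f‖) 0, _, _, rfl⟩, 0, le_rfl, fun p => ?_, fun p _ => ?_⟩
      all_goals
        have := (abs_le.1 (f.norm_coe_le_norm p)).1
        simp [hpr]
        linarith)
  have hLpr : ∀ φ ψ, L (pr φ ψ) = ∫ x, φ x ∂μ + ∫ y, ψ y ∂ν := fun φ ψ =>
    (hLV ⟨pr φ ψ, φ, ψ, rfl⟩).trans (hIpr φ ψ)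
  obtain ⟨π, hπ, hπL⟩ := exists_measure_integral_eq_of_nonneg L fun f hf =>
    hLs f ⟨0, le_rfl, by simpa using hf, fun p _ => by simpa using hf p⟩
  refine ⟨π, ?_, ?_, le_measureReal_of_forall_le_integral π hF fun f hf0 hf1 => ?_⟩
  · refine ext_of_forall_integral_eq_of_IsFiniteMeasure fun f => ?_
    rw [integral_map measurable_fst.aemeasurable f.continuous.aestronglyMeasurable]
    have := (hπL (pr f 0)).trans (hLpr f 0)
    simpa [hpr] using this
  · refine ext_of_forall_integral_eq_of_IsFiniteMeasure fun f => ?_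
    rw [integral_map measurable_snd.aemeasurable f.continuous.aestronglyMeasurable]
    have := (hπL (pr 0 f)).trans (hLpr 0 f)
    simpa [hpr] using this
  · have h1 := hLs (f - pr (ContinuousMap.const X P) 0) ⟨1, zero_le_one, fun p => ?_, fun p hp => ?_⟩
    · rw [map_sub, hLpr, ← hπL] at h1
      simpa using h1
    · have := hf0 p
      simp [hpr]
      linarith
    · have := hf1 p hp
      simp [hpr]
      linarith

/-- Increasing measurable functions with values in `[0, 1]`. -/
def unitMonotone (S : Type*) [MeasurableSpace S] [Preorder S] : Set (S → ℝ) :=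
  {h | Monotone h ∧ Measurable h ∧ (∀ x, 0 ≤ h x) ∧ ∀ x, h x ≤ 1}

section

open Filter Topology

variable {S : Type*} [MeasurableSpace S] [Preorder S]

lemma unitMonotone.norm_le {h : S → ℝ} (hh : h ∈ unitMonotone S) (x : S) : ‖h x‖ ≤ 1 := by
  rw [Real.norm_of_nonneg (hh.2.2.1 x)]
  exact hh.2.2.2 x

lemma unitMonotone.integrable {h : S → ℝ} (hh : h ∈ unitMonotone S)
    (m : Measure S) [IsFiniteMeasure m] : Integrable h m :=
  .of_bound hh.2.1.aestronglyMeasurable 1 (.of_forall (unitMonotone.norm_le hh))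

lemma unitMonotone.sup_mem {f g : S → ℝ} (hf : f ∈ unitMonotone S) (hg : g ∈ unitMonotone S) :
    f ⊔ g ∈ unitMonotone S :=
  ⟨hf.1.sup hg.1, hf.2.1.sup hg.2.1, fun x => le_sup_of_le_left (hf.2.2.1 x),
    fun x => sup_le (hf.2.2.2 x) (hg.2.2.2 x)⟩

lemma unitMonotone.inf_mem {f g : S → ℝ} (hf : f ∈ unitMonotone S) (hg : g ∈ unitMonotone S) :
    f ⊓ g ∈ unitMonotone S :=
  ⟨hf.1.inf hg.1, hf.2.1.inf hg.2.1, fun x => le_inf (hf.2.2.1 x) (hg.2.2.1 x),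
    fun x => inf_le_of_left_le (hf.2.2.2 x)⟩

lemma unitMonotone.mem_of_tendsto {F : ℕ → S → ℝ} {h : S → ℝ} (hF : ∀ n, F n ∈ unitMonotone S)
    (hlim : ∀ x, Tendsto (fun n => F n x) atTop (𝓝 (h x))) : h ∈ unitMonotone S :=
  ⟨fun x y hxy => le_of_tendsto_of_tendsto' (hlim x) (hlim y) fun n => (hF n).1 hxy,
    measurable_of_tendsto_metrizable (fun n => (hF n).2.1) (tendsto_pi_nhds.2 hlim),
    fun x => ge_of_tendsto' (hlim x) fun n => (hF n).2.2.1 x,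
    fun x => le_of_tendsto' (hlim x) fun n => (hF n).2.2.2 x⟩

lemma unitMonotone.tendsto_integral {F : ℕ → S → ℝ} {h : S → ℝ} (hF : ∀ n, F n ∈ unitMonotone S)
    (hlim : ∀ x, Tendsto (fun n => F n x) atTop (𝓝 (h x))) (m : Measure S) [IsFiniteMeasure m] :
    Tendsto (fun n => ∫ x, F n x ∂m) atTop (𝓝 (∫ x, h x ∂m)) :=
  tendsto_integral_of_dominated_convergence (fun _ => 1)
    (fun n => (hF n).2.1.aestronglyMeasurable) (integrable_const _)
    (fun n => .of_forall (unitMonotone.norm_le (hF n))) (.of_forall hlim)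

/-- The difference of the integrals against two finite measures attains its maximum over the
increasing measurable functions with values in `[0, 1]`. -/
lemma unitMonotone.exists_isMaxOn (μ ν : Measure S) [IsFiniteMeasure μ] [IsFiniteMeasure ν] :
    ∃ h ∈ unitMonotone S,
      IsMaxOn (fun h : S → ℝ => ∫ x, h x ∂μ - ∫ x, h x ∂ν) (unitMonotone S) h := by
  let val : (S → ℝ) → ℝ := fun h => ∫ x, h x ∂μ - ∫ x, h x ∂ν
  have htend : ∀ {F : ℕ → S → ℝ} {h : S → ℝ}, (∀ n, F n ∈ unitMonotone S) →
      (∀ x, Tendsto (fun n => F n x) atTop (𝓝 (h x))) →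
      Tendsto (fun n => val (F n)) atTop (𝓝 (val h)) := fun hF hlim =>
    (unitMonotone.tendsto_integral hF hlim μ).sub (unitMonotone.tendsto_integral hF hlim ν)
  have hne : (val '' unitMonotone S).Nonempty :=
    ⟨_, 0, ⟨monotone_const, measurable_const, fun _ => le_rfl, fun _ => zero_le_one⟩, rfl⟩
  have hbdd : BddAbove (val '' unitMonotone S) := by
    refine ⟨∫ _, 1 ∂μ, ?_⟩
    rintro _ ⟨h, hh, rfl⟩
    have h1 : ∫ x, h x ∂μ ≤ ∫ _, 1 ∂μ :=
      integral_mono (unitMonotone.integrable hh μ) (integrable_const _) hh.2.2.2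
    have h2 : 0 ≤ ∫ x, h x ∂ν := integral_nonneg hh.2.2.1
    simp only [val]
    linarith
  set D := sSup (val '' unitMonotone S)
  have hle : ∀ h ∈ unitMonotone S, val h ≤ D := fun h hh => le_csSup hbdd ⟨h, hh, rfl⟩
  have hsup : ∀ f ∈ unitMonotone S, ∀ g ∈ unitMonotone S, val f + val g - D ≤ val (f ⊔ g) := by
    intro f hf g hg
    have key : ∀ (m : Measure S) [IsFiniteMeasure m],
        ∫ x, (f ⊔ g) x ∂m + ∫ x, (f ⊓ g) x ∂m = ∫ x, f x ∂m + ∫ x, g x ∂m := fun m _ => by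
      rw [← integral_add (unitMonotone.integrable (unitMonotone.sup_mem hf hg) m)
        (unitMonotone.integrable (unitMonotone.inf_mem hf hg) m),
        ← integral_add (unitMonotone.integrable hf m) (unitMonotone.integrable hg m)]
      exact integral_congr_ae (.of_forall fun x => max_add_min _ _)
    have h1 := key μ
    have h2 := key ν
    have h3 := hle _ (unitMonotone.inf_mem hf hg)
    simp only [val] at h3 ⊢
    linarith
  have hex : ∀ n : ℕ, ∃ f ∈ unitMonotone S, D - (1 / 2) ^ n < val f := fun n => by
    obtain ⟨_, ⟨f, hf, rfl⟩, hlt⟩ := exists_lt_of_lt_csSup hne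
      (show D - (1 / 2) ^ n < D from sub_lt_self _ (by positivity))
    exact ⟨f, hf, hlt⟩
  choose f hf hfD using hex
  let G : ℕ → ℕ → S → ℝ := fun n => partialSups fun k => f (n + k)
  have hG : ∀ n m, G n m ∈ unitMonotone S ∧
      D - 2 * (1 / 2) ^ n + (1 / 2) ^ (n + m) ≤ val (G n m) := by
    intro n m
    induction m with
    | zero =>
      have := hfD n
      simp only [G, partialSups_zero, add_zero]
      exact ⟨hf n, by linarith⟩
    | succ m ih =>
      have e : G n (m + 1) = G n m ⊔ f (n + (m + 1)) := partialSups_add_one _ _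
      rw [e]
      refine ⟨unitMonotone.sup_mem ih.1 (hf _), le_trans ?_ (hsup _ ih.1 _ (hf _))⟩
      have h1 := hfD (n + (m + 1))
      have h2 : (1 / 2 : ℝ) ^ (n + m) = 2 * (1 / 2) ^ (n + (m + 1)) := by ring
      linarith [ih.2]
  have hfb : ∀ n x, BddAbove (Set.range fun k => f (n + k) x) := fun n x =>
    ⟨1, by rintro _ ⟨k, rfl⟩; exact (hf _).2.2.2 x⟩
  let H : ℕ → S → ℝ := fun n x => ⨆ k, f (n + k) x
  have hGH : ∀ n x, Tendsto (fun m => G n m x) atTop (𝓝 (H n x)) := fun n x => by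
    have e : (fun m => G n m x) = partialSups fun k => f (n + k) x :=
      funext fun m => Pi.partialSups_apply _ _ _
    rw [e]
    have := tendsto_atTop_ciSup (partialSups fun k => f (n + k) x).monotone
      (bddAbove_range_partialSups.2 (hfb n x))
    rwa [ciSup_partialSups_eq (hfb n x)] at this
  have hH : ∀ n, H n ∈ unitMonotone S := fun n =>
    unitMonotone.mem_of_tendsto (fun m => (hG n m).1) (hGH n)
  have hHD : ∀ n, D - 2 * (1 / 2) ^ n ≤ val (H n) := fun n =>
    ge_of_tendsto' (htend (fun m => (hG n m).1) (hGH n)) fun m =>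
      le_trans (le_add_of_nonneg_right (by positivity)) (hG n m).2
  have hHlim : ∀ x, Tendsto (fun n => H n x) atTop (𝓝 (⨅ n, H n x)) := fun x =>
    tendsto_atTop_ciInf
      (antitone_nat_of_succ_le fun n => ciSup_le fun k => by
        have := le_ciSup (hfb n x) (1 + k)
        rwa [← add_assoc] at this)
      ⟨0, by rintro _ ⟨n, rfl⟩; exact (hH n).2.2.1 x⟩
  refine ⟨fun x => ⨅ n, H n x, unitMonotone.mem_of_tendsto hH hHlim, fun g hg => ?_⟩
  refine (hle g hg).trans (le_of_tendsto_of_tendsto' ?_ (htend hH hHlim) hHD)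
  have := (tendsto_pow_atTop_nhds_zero_of_lt_one (r := (1 / 2 : ℝ)) (by norm_num)
    (by norm_num)).const_mul 2
  simpa using this.const_sub D

end

/-- The supremum of a continuous `w : S → [0, 1]` over the points of a compact set lying below `y`
is a monotone measurable function of `y`. -/
lemma exists_monotone_measurable_envelope {S : Type*} [TopologicalSpace S]
    [MeasurableSpace S] [OpensMeasurableSpace S] [PartialOrder S]
    (hcl : IsClosed {p : S × S | p.1 ≤ p.2}) {C : Set S} (hC : IsCompact C)
    {w : S → ℝ} (hw : Continuous w) (hw0 : ∀ x, 0 ≤ w x) (hw1 : ∀ x, w x ≤ 1) :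
    ∃ h ∈ unitMonotone S, (∀ x ∈ C, w x ≤ h x) ∧
      ∀ y b, 0 ≤ b → (∀ x ∈ C, x ≤ y → w x ≤ b) → h y ≤ b := by
  have : OrderClosedTopology S := ⟨hcl⟩
  let h : S → ℝ := fun y => sSup (w '' (C ∩ Set.Iic y))
  have hbdd : ∀ y, BddAbove (w '' (C ∩ Set.Iic y)) := fun y =>
    ⟨1, by rintro _ ⟨x, -, rfl⟩; exact hw1 x⟩
  have h0 : ∀ y, 0 ≤ h y := fun y =>
    Real.sSup_nonneg (by rintro _ ⟨x, -, rfl⟩; exact hw0 x)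
  have hle : ∀ x ∈ C, ∀ y, x ≤ y → w x ≤ h y := fun x hx y hxy =>
    le_csSup (hbdd y) ⟨x, ⟨hx, hxy⟩, rfl⟩
  have hub : ∀ y b, 0 ≤ b → (∀ x ∈ C, x ≤ y → w x ≤ b) → h y ≤ b := fun y b hb hxb =>
    Real.sSup_le (by rintro _ ⟨x, ⟨hx, hxy⟩, rfl⟩; exact hxb x hx hxy) hb
  refine ⟨h, ⟨fun y z hyz => hub y _ (h0 z) fun x hx hxy => hle x hx z (hxy.trans hyz),
    measurable_of_Ici fun t => ?_, h0, fun y => hub y 1 zero_le_one fun x _ _ => hw1 x⟩,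
    fun x hx => hle x hx x le_rfl, hub⟩
  rcases le_or_gt t 0 with ht | ht
  · convert MeasurableSet.univ
    exact Set.eq_univ_of_forall fun y => ht.trans (h0 y)
  · let A : Set S := C ∩ {x | t ≤ w x}
    have hA : IsCompact A := hC.inter_right (isClosed_le continuous_const hw)
    have : CompactSpace A := isCompact_iff_compactSpace.1 hA
    have hcl' : IsClosed {p : A × S | (p.1 : S) ≤ p.2} := isClosed_le (by fun_prop) (by fun_prop)
    convert (isClosedMap_snd_of_compactSpace _ hcl').measurableSet
    ext y
    constructor
    · intro hy
      have hne : (C ∩ Set.Iic y).Nonempty := by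
        by_contra hne
        rw [Set.not_nonempty_iff_eq_empty] at hne
        have : t ≤ h y := hy
        simp only [h, hne, Set.image_empty, Real.sSup_empty] at this
        linarith
      obtain ⟨x, ⟨hx, hxy⟩, hxe⟩ := (hC.inter_right isClosed_Iic).exists_sSup_image_eq hne
        hw.continuousOn
      exact ⟨(⟨x, hx, hy.trans_eq hxe⟩, y), hxy, rfl⟩
    · rintro ⟨⟨⟨x, hx, hxt⟩, y'⟩, hxy, rfl⟩
      exact le_trans hxt (hle x hx _ hxy)

/-- A bound on the increasing dual functionals yields couplings nearly attaining it. -/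
lemma exists_coupling_of_forall_monotone_le {S : Type*} [TopologicalSpace S] [PolishSpace S]
    [MeasurableSpace S] [BorelSpace S] [PartialOrder S]
    (hcl : IsClosed {p : S × S | p.1 ≤ p.2})
    (μ ν : Measure S) [IsProbabilityMeasure μ] [IsProbabilityMeasure ν] {D : ℝ}
    (hD : ∀ h ∈ unitMonotone S, ∫ x, h x ∂μ - ∫ x, h x ∂ν ≤ D) {ε : ℝ} (hε : 0 < ε) :
    ∃ π : Measure (S × S), π.map Prod.fst = μ ∧ π.map Prod.snd = ν ∧
      1 - D - 2 * ε ≤ π.real {p : S × S | p.1 ≤ p.2} := by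
  have hbd : ∀ (m : Measure S) [IsProbabilityMeasure m] {f : S → ℝ} (B : ℝ), Measurable f →
      (∀ x, ‖f x‖ ≤ B) → Integrable f m := fun m _ f B hf hB =>
    Integrable.of_bound hf.aestronglyMeasurable B (.of_forall hB)
  obtain ⟨C, hC, hCμ, hCν⟩ : ∃ C : Set S, IsCompact C ∧ μ.real Cᶜ ≤ ε ∧ ν.real Cᶜ ≤ ε := by
    have ht := (isTightMeasureSet_singleton (μ := μ)).union (isTightMeasureSet_singleton (μ := ν))
    obtain ⟨C, hC, h⟩ := isTightMeasureSet_iff_exists_isCompact_measure_compl_le.1 ht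
      (ENNReal.ofReal ε) (ENNReal.ofReal_pos.2 hε)
    exact ⟨C, hC, ENNReal.toReal_le_of_le_ofReal hε.le (h μ (by simp)),
      ENNReal.toReal_le_of_le_ofReal hε.le (h ν (by simp))⟩
  let _ : MetricSpace S := TopologicalSpace.metrizableSpaceMetric S
  obtain ⟨ι, hι⟩ := Metric.PiNatEmbed.exists_embedding_to_hilbert_cube (X := S)
  have hιm : MeasurableEmbedding ι := hι.continuous.measurableEmbedding hι.injective
  have := Measure.isProbabilityMeasure_map (μ := μ) hιm.measurable.aemeasurable
  have := Measure.isProbabilityMeasure_map (μ := ν) hιm.measurable.aemeasurable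
  let J : S × S → (ℕ → unitInterval) × (ℕ → unitInterval) := Prod.map ι ι
  have hJ : MeasurableEmbedding J := hιm.prodMap hιm
  let K : Set (S × S) := {p | p.1 ≤ p.2} ∩ C ×ˢ C
  have hK : IsCompact K := (hC.prod hC).inter_left hcl
  have hF : IsClosed (J '' K) := (hK.image (hι.continuous.prodMap hι.continuous)).isClosed
  obtain ⟨π, hπ1, hπ2, hπ⟩ := exists_coupling_le_measureReal_of_compactSpace (μ.map ι) (ν.map ι) hF
    (P := 1 - D - 2 * ε) (fun φ ψ h1 h2 => by
      rw [integral_map hιm.measurable.aemeasurable φ.continuous.aestronglyMeasurable,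
        integral_map hιm.measurable.aemeasurable ψ.continuous.aestronglyMeasurable]
      obtain ⟨z, hz⟩ : ∃ z, ∀ x, φ z ≤ φ x := by
        obtain ⟨z, -, hz⟩ := isCompact_univ.exists_isMinOn Set.univ_nonempty φ.continuous.continuousOn
        exact ⟨z, fun x => hz (Set.mem_univ x)⟩
      let u : S → ℝ := fun x => φ (ι x) - φ z
      let v : S → ℝ := fun x => ψ (ι x) + φ z
      have hu : Continuous u := by have := hι.continuous; fun_prop
      have hv : Continuous v := by have := hι.continuous; fun_prop
      have hu0 : ∀ x, 0 ≤ u x := fun x => sub_nonneg.2 (hz _)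
      have hv0 : ∀ x, 0 ≤ v x := fun x => by have := h1 z (ι x); simp only [v]; linarith
      have hub : ∀ x, ‖u x‖ ≤ ‖φ‖ + ‖φ‖ := fun x =>
        (norm_sub_le _ _).trans (add_le_add (φ.norm_coe_le_norm _) (φ.norm_coe_le_norm _))
      have hvb : ∀ x, ‖v x‖ ≤ ‖ψ‖ + ‖φ‖ := fun x =>
        (norm_add_le _ _).trans (add_le_add (ψ.norm_coe_le_norm _) (φ.norm_coe_le_norm _))
      have hui := hbd μ _ hu.measurable hub
      have hvi := hbd ν _ hv.measurable hvb
      obtain ⟨h, hh, hlow, hup⟩ := exists_monotone_measurable_envelope hcl hC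
        (w := fun x => max 0 (1 - u x)) (by fun_prop) (fun x => le_max_left _ _)
        (fun x => max_le zero_le_one (by linarith [hu0 x]))
      have hCm : MeasurableSet Cᶜ := hC.measurableSet.compl
      have hind : ∀ (m : Measure S) [IsProbabilityMeasure m],
          Integrable (Cᶜ.indicator (1 : S → ℝ)) m := fun m _ =>
        (integrable_const (1 : ℝ)).indicator hCm
      have i1 : ∫ x, (1 - u x - Cᶜ.indicator 1 x) ∂μ ≤ ∫ x, h x ∂μ := by
        refine integral_mono (((integrable_const _).sub hui).sub (hind μ))
          (unitMonotone.integrable hh μ) fun x => ?_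
        by_cases hx : x ∈ C
        · simpa [hx] using (le_max_right _ _).trans (hlow x hx)
        · have := hh.2.2.1 x; have := hu0 x; simp [hx]; linarith
      have i2 : ∫ x, h x ∂ν ≤ ∫ x, (v x + Cᶜ.indicator 1 x) ∂ν := by
        refine integral_mono (unitMonotone.integrable hh ν) (hvi.add (hind ν)) fun y => ?_
        by_cases hy : y ∈ C
        · simp only [Set.mem_compl_iff, hy, not_true_eq_false, not_false_eq_true,
            Set.indicator_of_notMem, add_zero]
          refine hup y _ (hv0 y) fun x hx hxy => max_le (hv0 y) ?_
          have := h2 (J (x, y)) ⟨(x, y), ⟨hxy, hx, hy⟩, rfl⟩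
          simp only [J, Prod.map] at this
          simp only [u, v]
          linarith
        · have := hh.2.2.2 y; have := hv0 y; simp [hy]; linarith
      rw [integral_sub (f := fun x => 1 - u x) ((integrable_const _).sub hui) (hind μ),
        integral_sub (integrable_const _) hui, integral_indicator_one hCm] at i1
      rw [integral_add hvi (hind ν), integral_indicator_one hCm] at i2
      have hφi : Integrable (fun x => φ (ι x)) μ :=
        hbd μ ‖φ‖ (φ.continuous.comp hι.continuous).measurable fun x => φ.norm_coe_le_norm _
      have hψi : Integrable (fun x => ψ (ι x)) ν :=
        hbd ν ‖ψ‖ (ψ.continuous.comp hι.continuous).measurable fun x => ψ.norm_coe_le_norm _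
      have e1 : ∫ x, u x ∂μ = ∫ x, φ (ι x) ∂μ - φ z := by
        rw [integral_sub hφi (integrable_const _)]; simp
      have e2 : ∫ x, v x ∂ν = ∫ x, ψ (ι x) ∂ν + φ z := by
        rw [integral_add hψi (integrable_const _)]; simp
      have := hD h hh
      simp only [integral_const, probReal_univ, smul_eq_mul, mul_one] at i1
      linarith)
  have hr : ∀ᵐ p ∂π, p ∈ Set.range J := by
    have r1 : ∀ᵐ x ∂π.map Prod.fst, x ∈ Set.range ι := by
      rw [hπ1]
      exact (ae_map_iff hιm.measurable.aemeasurable hιm.measurableSet_range).2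
        (.of_forall fun x => ⟨x, rfl⟩)
    have r2 : ∀ᵐ x ∂π.map Prod.snd, x ∈ Set.range ι := by
      rw [hπ2]
      exact (ae_map_iff hιm.measurable.aemeasurable hιm.measurableSet_range).2
        (.of_forall fun x => ⟨x, rfl⟩)
    filter_upwards [ae_of_ae_map measurable_fst.aemeasurable r1,
      ae_of_ae_map measurable_snd.aemeasurable r2] with p hp1 hp2
    rw [Set.range_prodMap]
    exact ⟨hp1, hp2⟩
  have hmap : (π.comap J).map J = π := by
    rw [hJ.map_comap, Measure.restrict_eq_self_of_ae_mem hr]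
  have hinj : ∀ m m' : Measure S, m.map ι = m'.map ι → m = m' := fun m m' h => by
    rw [← hιm.comap_map m, h, hιm.comap_map]
  refine ⟨π.comap J, hinj _ _ ?_, hinj _ _ ?_, ?_⟩
  · rw [Measure.map_map hιm.measurable measurable_fst, ← hπ1, ← hmap,
      Measure.map_map measurable_fst hJ.measurable, hmap]
    rfl
  · rw [Measure.map_map hιm.measurable measurable_snd, ← hπ2, ← hmap,
      Measure.map_map measurable_snd hJ.measurable, hmap]
    rfl
  · refine hπ.trans ?_
    have hfin : IsFiniteMeasure π := by
      have : IsProbabilityMeasure (π.map Prod.fst) := hπ1 ▸ inferInstance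
      have := Measure.isProbabilityMeasure_of_map (μ := π) Prod.fst
      infer_instance
    rw [measureReal_def, measureReal_def, hJ.comap_apply]
    exact ENNReal.toReal_mono (measure_ne_top _ _)
      (measure_mono (Set.image_mono Set.inter_subset_left))

/-- Weak duality: a coupling gives the order relation mass at most one minus the value of an
increasing dual functional. -/
lemma unitMonotone.measure_le_of_coupling {S : Type*} [TopologicalSpace S]
    [SecondCountableTopology S] [MeasurableSpace S] [BorelSpace S] [PartialOrder S]
    (hcl : IsClosed {p : S × S | p.1 ≤ p.2}) {h : S → ℝ} (hh : h ∈ unitMonotone S)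
    (π : Measure (S × S)) [IsProbabilityMeasure π] :
    π {p : S × S | p.1 ≤ p.2} ≤
      ENNReal.ofReal (1 - (∫ x, h x ∂(π.map Prod.fst) - ∫ x, h x ∂(π.map Prod.snd))) := by
  have h1 : Integrable (fun p : S × S => h p.1) π :=
    .of_bound (hh.2.1.comp measurable_fst).aestronglyMeasurable 1
      (.of_forall fun p => unitMonotone.norm_le hh p.1)
  have h2 : Integrable (fun p : S × S => h p.2) π :=
    .of_bound (hh.2.1.comp measurable_snd).aestronglyMeasurable 1
      (.of_forall fun p => unitMonotone.norm_le hh p.2)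
  rw [integral_map measurable_fst.aemeasurable hh.2.1.aestronglyMeasurable,
    integral_map measurable_snd.aemeasurable hh.2.1.aestronglyMeasurable, ← integral_sub h1 h2]
  have key : π.real {p : S × S | p.1 ≤ p.2} ≤ ∫ p, (1 - (h p.1 - h p.2)) ∂π := by
    rw [← integral_indicator_one hcl.measurableSet]
    refine integral_mono ((integrable_const (1 : ℝ)).indicator hcl.measurableSet)
      ((integrable_const _).sub (h1.sub h2)) fun p => ?_
    by_cases hp : p.1 ≤ p.2
    · have := hh.1 hp
      simp [hp]
      linarith
    · have := hh.2.2.2 p.1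
      have := hh.2.2.1 p.2
      simp [hp]
      linarith
  rw [integral_sub (g := fun p : S × S => h p.1 - h p.2) (integrable_const _) (h1.sub h2)] at key
  rw [← ofReal_measureReal]
  exact ENNReal.ofReal_le_ofReal (by simpa using key)

/-- An increasing measurable function of oscillation at most one is a translate of one with values
in `[0, 1]`. -/
lemma exists_sub_const_mem_unitMonotone {S : Type*} [MeasurableSpace S] [Preorder S] [Nonempty S]
    {h : S → ℝ} (hmono : Monotone h) (hmeas : Measurable h) (hosc : ∀ x y, h x - h y ≤ 1) :
    ∃ a, (fun x => h x - a) ∈ unitMonotone S := by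
  obtain ⟨z⟩ := ‹Nonempty S›
  have hb : BddBelow (Set.range h) := ⟨h z - 1, by rintro _ ⟨y, rfl⟩; linarith [hosc z y]⟩
  have : Nonempty S := ⟨z⟩
  refine ⟨⨅ x, h x, fun x y hxy => sub_le_sub_right (hmono hxy) _, hmeas.sub_const _,
    fun x => sub_nonneg.2 (ciInf_le hb x), fun x => ?_⟩
  have : h x - 1 ≤ ⨅ x, h x := le_ciInf fun y => by linarith [hosc x y]
  linarith

/-- Kantorovich duality for `τ`: on a Polish space with closed partial order and probability
measures `μ, ν`, `τ(μ, ν) = 1 − max` over decreasing Borel `g` with `osc(g) ≤ 1` of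
`∫g dν − ∫g dμ`, and equivalently `τ(μ, ν) = 1 − max` over increasing Borel `h` with
`osc(h) ≤ 1` of `∫h dμ − ∫h dν`. -/
theorem tau_kantorovich_duality {S : Type*} [TopologicalSpace S] [PolishSpace S]
    [MeasurableSpace S] [BorelSpace S] [PartialOrder S]
    (hcl : IsClosed {p : S × S | p.1 ≤ p.2})
    (μ ν : Measure S) [IsProbabilityMeasure μ] [IsProbabilityMeasure ν] :
    (∃ g : S → ℝ, Antitone g ∧ Measurable g ∧ (∀ x y, g x - g y ≤ 1) ∧
      (∀ g' : S → ℝ, Antitone g' → Measurable g' → (∀ x y, g' x - g' y ≤ 1) →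
        ∫ x, g' x ∂ν - ∫ x, g' x ∂μ ≤ ∫ x, g x ∂ν - ∫ x, g x ∂μ) ∧
      (⨆ (π : Measure (S × S)) (_ : π.map Prod.fst = μ ∧ π.map Prod.snd = ν),
          π {p : S × S | p.1 ≤ p.2}).toReal
        = 1 - (∫ x, g x ∂ν - ∫ x, g x ∂μ)) ∧
    (∃ h : S → ℝ, Monotone h ∧ Measurable h ∧ (∀ x y, h x - h y ≤ 1) ∧
      (∀ h' : S → ℝ, Monotone h' → Measurable h' → (∀ x y, h' x - h' y ≤ 1) →
        ∫ x, h' x ∂μ - ∫ x, h' x ∂ν ≤ ∫ x, h x ∂μ - ∫ x, h x ∂ν) ∧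
      (⨆ (π : Measure (S × S)) (_ : π.map Prod.fst = μ ∧ π.map Prod.snd = ν),
          π {p : S × S | p.1 ≤ p.2}).toReal
        = 1 - (∫ x, h x ∂μ - ∫ x, h x ∂ν)) := by
  have hS : Nonempty S := nonempty_of_isProbabilityMeasure μ
  obtain ⟨h, hh, hmax⟩ := unitMonotone.exists_isMaxOn (S := S) μ ν
  have hosc : ∀ x y, h x - h y ≤ 1 := fun x y => by linarith [hh.2.2.2 x, hh.2.2.1 y]
  have hopt : ∀ h' : S → ℝ, Monotone h' → Measurable h' → (∀ x y, h' x - h' y ≤ 1) →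
      ∫ x, h' x ∂μ - ∫ x, h' x ∂ν ≤ ∫ x, h x ∂μ - ∫ x, h x ∂ν := by
    intro h' hmono hmeas hosc'
    obtain ⟨a, ha⟩ := exists_sub_const_mem_unitMonotone hmono hmeas hosc'
    have hint : ∀ (m : Measure S) [IsProbabilityMeasure m],
        ∫ x, h' x ∂m = ∫ x, (h' x - a) ∂m + a := fun m _ => by
      simpa using integral_add (unitMonotone.integrable ha m) (integrable_const a)
    rw [hint μ, hint ν, add_sub_add_right_eq_sub]
    exact hmax ha
  have hτ : (⨆ (π : Measure (S × S)) (_ : π.map Prod.fst = μ ∧ π.map Prod.snd = ν),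
      π {p : S × S | p.1 ≤ p.2}).toReal = 1 - (∫ x, h x ∂μ - ∫ x, h x ∂ν) := by
    have hle : (⨆ (π : Measure (S × S)) (_ : π.map Prod.fst = μ ∧ π.map Prod.snd = ν),
        π {p : S × S | p.1 ≤ p.2}) ≤ ENNReal.ofReal (1 - (∫ x, h x ∂μ - ∫ x, h x ∂ν)) := by
      refine iSup₂_le fun π hπ => ?_
      have : IsProbabilityMeasure (π.map Prod.fst) := hπ.1 ▸ inferInstance
      have := Measure.isProbabilityMeasure_of_map (μ := π) Prod.fst
      have := unitMonotone.measure_le_of_coupling hcl hh π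
      rwa [hπ.1, hπ.2] at this
    have hnn : 0 ≤ 1 - (∫ x, h x ∂μ - ∫ x, h x ∂ν) := by
      have h1 : ∫ x, h x ∂μ ≤ ∫ _, 1 ∂μ :=
        integral_mono (unitMonotone.integrable hh μ) (integrable_const _) hh.2.2.2
      have h2 : 0 ≤ ∫ x, h x ∂ν := integral_nonneg hh.2.2.1
      simp only [integral_const, probReal_univ, smul_eq_mul, mul_one] at h1
      linarith
    refine le_antisymm (ENNReal.toReal_le_of_le_ofReal hnn hle)
      (le_of_forall_pos_sub_le fun ε hε => ?_)
    obtain ⟨π, hπ1, hπ2, hπ⟩ := exists_coupling_of_forall_monotone_le hcl μ ν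
      (fun h' hh' => hmax hh') (half_pos hε)
    rw [mul_div_cancel₀ _ two_ne_zero] at hπ
    exact hπ.trans (ENNReal.toReal_mono (hle.trans_lt ENNReal.ofReal_lt_top).ne
      (le_iSup₂_of_le π ⟨hπ1, hπ2⟩ le_rfl))
  have hneg : ∫ x, -h x ∂ν - ∫ x, -h x ∂μ = ∫ x, h x ∂μ - ∫ x, h x ∂ν := by
    rw [integral_neg, integral_neg]
    ring
  refine ⟨⟨fun x => -h x, hh.1.neg, hh.2.1.neg, fun x y => by linarith [hosc y x], ?_,
    hneg.symm ▸ hτ⟩, h, hh.1, hh.2.1, hosc, hopt, hτ⟩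
  intro g hanti hmeas hosc'
  have := hopt (fun x => -g x) hanti.neg hmeas.neg fun x y => by linarith [hosc' y x]
  rw [integral_neg, integral_neg] at this
  rw [hneg]
  linarith
end

section
/- τ satisfies the mixture axiom: if μ = λμ_a + (1−λ)μ_b and ν = λν_a + (1−λ)ν_b for probability measures μ_a, μ_b, ν_a, ν_b, λ ∈ [0,1], and μ_a ⪯_sd ν_a, then τ(μ, ν) ≥ λ. -/
open MeasureTheory

/-- Stochastic dominance for finite measures. -/
def StochDom {S : Type*} [MeasurableSpace S] [Preorder S] (μ ν : Measure S) : Prop :=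
  μ Set.univ = ν Set.univ ∧
    ∀ h : S → ℝ, Measurable h → Monotone h → (∃ C, ∀ x, |h x| ≤ C) →
      ∫ x, h x ∂μ ≤ ∫ x, h x ∂ν

open Set TopologicalSpace

/-- In a space with closed order, the set of points lying below a compact set is closed. -/
theorem isClosed_setOf_exists_ge_of_isCompact {S : Type*} [TopologicalSpace S] [LE S]
    (hcl : IsClosed {p : S × S | p.1 ≤ p.2}) {K : Set S} (hK : IsCompact K) :
    IsClosed {x : S | ∃ y ∈ K, x ≤ y} := by
  have : CompactSpace K := isCompact_iff_compactSpace.mp hK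
  have hpre : IsClosed {p : S × K | p.1 ≤ (p.2 : S)} :=
    hcl.preimage (f := fun p : S × K => (p.1, (p.2 : S))) (by fun_prop)
  convert isClosedMap_fst_of_compactSpace _ hpre using 1
  ext x
  simp

section Dominance

variable {S : Type*} [TopologicalSpace S] [PolishSpace S] [MeasurableSpace S] [BorelSpace S]
  [PartialOrder S] {μ ν : Measure S} [IsProbabilityMeasure μ] [IsProbabilityMeasure ν]

/-- If `F` contains every point below a Borel set `A`, then stochastic dominance of `μ` by `ν`
gives `ν A ≤ μ F`. -/
theorem StochDom.measure_le (hsd : StochDom μ ν) (hcl : IsClosed {p : S × S | p.1 ≤ p.2})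
    {A F : Set S} (hA : MeasurableSet A) (hAF : ∀ x, ∀ y ∈ A, x ≤ y → x ∈ F) :
    ν A ≤ μ F := by
  refine le_of_forall_lt fun r hr => ?_
  obtain ⟨K, hKA, hK, hrK⟩ := hA.exists_lt_isCompact hr
  refine hrK.trans_le ?_
  set L : Set S := {x | ∃ y ∈ K, x ≤ y} with hL
  have hLm : MeasurableSet L := (isClosed_setOf_exists_ge_of_isCompact hcl hK).measurableSet
  have hmono : Monotone fun x => -L.indicator (fun _ => (1 : ℝ)) x := by
    intro x y hxy
    by_cases hy : y ∈ L
    · have hx : x ∈ L := by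
        obtain ⟨z, hz, hyz⟩ := hy
        exact ⟨z, hz, hxy.trans hyz⟩
      simp [hx, hy]
    · by_cases hx : x ∈ L <;> simp [hx, hy]
  have hInt := hsd.2 (fun x => -L.indicator (fun _ => (1 : ℝ)) x)
    ((measurable_const.indicator hLm).neg) hmono
    ⟨1, fun x => by by_cases hx : x ∈ L <;> simp [hx]⟩
  rw [integral_neg, integral_neg, integral_indicator_const _ hLm, integral_indicator_const _ hLm,
    neg_le_neg_iff] at hInt
  simp only [smul_eq_mul, mul_one] at hInt
  calc ν K ≤ ν L := measure_mono fun x hx => ⟨x, hx, le_rfl⟩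
    _ ≤ μ L := (ENNReal.toReal_le_toReal (measure_ne_top _ _) (measure_ne_top _ _)).1 hInt
    _ ≤ μ F := measure_mono fun x ⟨y, hy, hxy⟩ => hAF x y (hKA hy) hxy

/-- Weak duality for stochastic dominance: if `g y ≤ f x` whenever `x ≤ y`, then
`∫ g ∂ν ≤ ∫ f ∂μ`. -/
theorem StochDom.integral_le_integral (hsd : StochDom μ ν)
    (hcl : IsClosed {p : S × S | p.1 ≤ p.2}) {f g : S → ℝ} (hf : Measurable f)
    (hg : Measurable g) {C : ℝ} (hfC : ∀ x, |f x| ≤ C) (hgC : ∀ x, |g x| ≤ C)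
    (hfg : ∀ x y, x ≤ y → g y ≤ f x) :
    ∫ y, g y ∂ν ≤ ∫ x, f x ∂μ := by
  have hfi : Integrable f μ := .of_bound hf.aestronglyMeasurable C (.of_forall hfC)
  have hgi : Integrable g ν := .of_bound hg.aestronglyMeasurable C (.of_forall hgC)
  have hf0 : ∀ x, 0 ≤ f x + C := fun x => by linarith [neg_le_of_abs_le (hfC x)]
  have hg0 : ∀ x, 0 ≤ g x + C := fun x => by linarith [neg_le_of_abs_le (hgC x)]
  have hlint : ∫⁻ y, ENNReal.ofReal (g y + C) ∂ν ≤ ∫⁻ x, ENNReal.ofReal (f x + C) ∂μ := by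
    rw [lintegral_eq_lintegral_meas_le ν (.of_forall hg0) (hg.add_const C).aemeasurable,
      lintegral_eq_lintegral_meas_le μ (.of_forall hf0) (hf.add_const C).aemeasurable]
    refine lintegral_mono fun t => hsd.measure_le hcl
      (measurableSet_le measurable_const (hg.add_const C)) fun x y hy hxy => ?_
    have hy' : t ≤ g y + C := hy
    have := hfg x y hxy
    change t ≤ f x + C
    linarith
  have hshift : ∫ y, (g y + C) ∂ν ≤ ∫ x, (f x + C) ∂μ := by
    rw [integral_eq_lintegral_of_nonneg_ae (.of_forall hg0)
        (hg.add_const C).aestronglyMeasurable,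
      integral_eq_lintegral_of_nonneg_ae (.of_forall hf0) (hf.add_const C).aestronglyMeasurable]
    refine ENNReal.toReal_mono ?_ hlint
    exact (hfi.add (integrable_const C)).lintegral_lt_top.ne
  rw [integral_add hgi (integrable_const C), integral_add hfi (integrable_const C)] at hshift
  simpa using hshift

end Dominance

/-- Kantorovich duality on a compact space, in the feasibility form: a coupling of `μ` and `ν`
concentrated on the closure of `R` exists as soon as `∫ f ∂μ + ∫ g ∂ν ≥ 0` for all continuous `f`
and `g` with `f x + g y ≥ 0` on `R`. -/
theorem exists_coupling_of_forall_integral_nonneg {H : Type*} [TopologicalSpace H]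
    [CompactSpace H] [MetrizableSpace H] [MeasurableSpace H] [BorelSpace H]
    (μ ν : Measure H) [IsProbabilityMeasure μ] [IsProbabilityMeasure ν] (R : Set (H × H))
    (hR : ∀ f g : C(H, ℝ), (∀ p ∈ R, 0 ≤ f p.1 + g p.2) → 0 ≤ ∫ x, f x ∂μ + ∫ y, g y ∂ν) :
    ∃ π : Measure (H × H), π.map Prod.fst = μ ∧ π.map Prod.snd = ν ∧ π (closure R)ᶜ = 0 := by
  let _ := metrizableSpaceMetric H
  have hInt : ∀ (ρ : Measure H) [IsProbabilityMeasure ρ] (f : C(H, ℝ)), Integrable f ρ :=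
    fun ρ _ f => f.continuous.integrable_of_hasCompactSupport (.of_compactSpace _)
  have hne : R.Nonempty := by
    by_contra! hempty
    have := hR (.const H (-1)) (.const H (-1)) (by simp [hempty])
    norm_num at this
  let Ccpt (c : C(H × H, ℝ)) : CompactlySupportedContinuousMap (H × H) ℝ :=
    ⟨c, .of_compactSpace _⟩
  let E := (C(H, ℝ) × C(H, ℝ)) × CompactlySupportedContinuousMap (H × H) ℝ
  let cone : PointedCone ℝ E :=
    { carrier := {e | ∀ p ∈ R, 0 ≤ e.1.1 p.1 + e.1.2 p.2 + e.2 p}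
      add_mem' := by
        intro a b ha hb p hp
        have h₁ := ha p hp
        have h₂ := hb p hp
        change 0 ≤ (a.1.1 p.1 + b.1.1 p.1) + (a.1.2 p.2 + b.1.2 p.2) + (a.2 p + b.2 p)
        linarith
      zero_mem' := by intro p _; simp
      smul_mem' := by
        intro c a ha p hp
        have h₁ := mul_nonneg c.2 (ha p hp)
        simp only [mul_add] at h₁
        exact h₁ }
  have hmem : ∀ e : E, e ∈ cone ↔ ∀ p ∈ R, 0 ≤ e.1.1 p.1 + e.1.2 p.2 + e.2 p := fun _ => Iff.rfl
  let I : C(H, ℝ) × C(H, ℝ) →ₗ[ℝ] ℝ :=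
    { toFun := fun q => ∫ x, q.1 x ∂μ + ∫ y, q.2 y ∂ν
      map_add' := by
        intro a b
        have h₁ := integral_add (hInt μ a.1) (hInt μ b.1)
        have h₂ := integral_add (hInt ν a.2) (hInt ν b.2)
        simp only [Prod.fst_add, Prod.snd_add, ContinuousMap.add_apply]
        rw [h₁, h₂]
        ring
      map_smul' := by
        intro c a
        simp only [Prod.smul_fst, Prod.smul_snd, ContinuousMap.smul_apply, smul_eq_mul,
          integral_const_mul, RingHom.id_apply]
        ring }
  let F : E →ₗ.[ℝ] ℝ :=
    { domain := LinearMap.ker (LinearMap.snd ℝ (C(H, ℝ) × C(H, ℝ)) _)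
      toFun := (I ∘ₗ LinearMap.fst ℝ _ _) ∘ₗ Submodule.subtype _ }
  obtain ⟨Λ, hΛF, hΛpos⟩ := riesz_extension cone F
    (by
      rintro ⟨⟨⟨f, g⟩, c⟩, hc⟩ he
      obtain rfl : c = 0 := hc
      exact hR f g fun p hp => by simpa using (hmem _).1 he p hp)
    (by
      rintro ⟨⟨f, g⟩, c⟩
      obtain ⟨M, hM⟩ := (isCompact_univ.image
        (show Continuous fun p : H × H => f p.1 + g p.2 + c p by fun_prop)).bddBelow
      refine ⟨⟨((.const H (-M), 0), 0), rfl⟩, fun p _ => ?_⟩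
      have hMp : M ≤ f p.1 + g p.2 + c p := hM ⟨p, mem_univ p, rfl⟩
      change 0 ≤ (-M + f p.1) + (0 + g p.2) + (0 + c p)
      linarith)
  have hΛI : ∀ f g : C(H, ℝ), Λ ((f, g), 0) = ∫ x, f x ∂μ + ∫ y, g y ∂ν :=
    fun f g => hΛF ⟨((f, g), 0), rfl⟩
  have hΛsplit : ∀ (f g : C(H, ℝ)) (c : CompactlySupportedContinuousMap (H × H) ℝ),
      (∀ p ∈ R, c p = f p.1 + g p.2) → Λ (0, c) = ∫ x, f x ∂μ + ∫ y, g y ∂ν := by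
    intro f g c hc
    have h₁ := hΛpos (-(f, g), c) fun p hp => by
      change 0 ≤ -f p.1 + -g p.2 + c p
      linarith [hc p hp]
    have h₂ := hΛpos ((f, g), -c) fun p hp => by
      change 0 ≤ f p.1 + g p.2 + -c p
      linarith [hc p hp]
    rw [show ((-(f, g), c) : E) = (0, c) - ((f, g), 0) by simp, map_sub, hΛI] at h₁
    rw [show (((f, g), -c) : E) = ((f, g), 0) - (0, c) by simp, map_sub, hΛI] at h₂
    linarith
  let Λ₀ := PositiveLinearMap.mk₀ (Λ ∘ₗ LinearMap.inr ℝ (C(H, ℝ) × C(H, ℝ)) _)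
    fun c hc => hΛpos (0, c) fun p _ => by simpa using hc p
  have hπ : ∀ c : C(H × H, ℝ), ∫ p, c p ∂(RealRMK.rieszMeasure Λ₀) = Λ (0, Ccpt c) :=
    fun c => RealRMK.integral_rieszMeasure Λ₀ (Ccpt c)
  refine ⟨RealRMK.rieszMeasure Λ₀, ?_, ?_, ?_⟩
  · refine ext_of_forall_integral_eq_of_IsFiniteMeasure fun f => ?_
    rw [integral_map measurable_fst.aemeasurable f.continuous.aestronglyMeasurable]
    refine (hπ (f.toContinuousMap.comp .fst)).trans ?_
    exact (hΛsplit f.toContinuousMap 0 _ fun p _ => by simp [Ccpt]).trans (by simp)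
  · refine ext_of_forall_integral_eq_of_IsFiniteMeasure fun f => ?_
    rw [integral_map measurable_snd.aemeasurable f.continuous.aestronglyMeasurable]
    refine (hπ (f.toContinuousMap.comp .snd)).trans ?_
    exact (hΛsplit 0 f.toContinuousMap _ fun p _ => by simp [Ccpt]).trans (by simp)
  · let d : C(H × H, ℝ) := ⟨fun p => Metric.infDist p R, Metric.continuous_infDist_pt R⟩
    have hd : ∫ p, d p ∂(RealRMK.rieszMeasure Λ₀) = 0 := by
      rw [hπ, hΛsplit 0 0 _ fun p hp => by simpa [Ccpt, d] using Metric.infDist_zero_of_mem hp]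
      simp
    rw [integral_eq_zero_iff_of_nonneg (f := d) (fun p => Metric.infDist_nonneg)
      (d.continuous.integrable_of_hasCompactSupport (.of_compactSpace _))] at hd
    refine mem_ae_iff.1 ?_
    filter_upwards [hd] with p hp
    exact (Metric.mem_closure_iff_infDist_zero hne).2 hp

/-- **Strassen's theorem**: stochastic dominance yields an almost surely ordered coupling. -/
theorem StochDom.exists_coupling {S : Type*} [TopologicalSpace S] [PolishSpace S]
    [MeasurableSpace S] [BorelSpace S] [PartialOrder S] {μ ν : Measure S}
    [IsProbabilityMeasure μ] [IsProbabilityMeasure ν] (hsd : StochDom μ ν)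
    (hcl : IsClosed {p : S × S | p.1 ≤ p.2}) :
    ∃ π : Measure (S × S), π.map Prod.fst = μ ∧ π.map Prod.snd = ν ∧
      π {p : S × S | p.1 ≤ p.2} = 1 := by
  let _ := metrizableSpaceMetric S
  obtain ⟨ι, hι⟩ := Metric.PiNatEmbed.exists_embedding_to_hilbert_cube (X := S)
  have hιm : MeasurableEmbedding ι := hι.continuous.measurableEmbedding hι.injective
  have hιι := hι.prodMap hι
  have hιιm : MeasurableEmbedding (Prod.map ι ι) :=
    hιι.continuous.measurableEmbedding hιι.injective
  have := Measure.isProbabilityMeasure_map (μ := μ) hιm.measurable.aemeasurable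
  have := Measure.isProbabilityMeasure_map (μ := ν) hιm.measurable.aemeasurable
  set R := Prod.map ι ι '' {p : S × S | p.1 ≤ p.2} with hR
  obtain ⟨ρ, hρ₁, hρ₂, hρR⟩ := exists_coupling_of_forall_integral_nonneg (μ.map ι) (ν.map ι) R
    (by
      intro f g hfg
      rw [hιm.integral_map, hιm.integral_map]
      have := hsd.integral_le_integral hcl (f := fun x => f (ι x)) (g := fun y => -g (ι y))
        (f.continuous.measurable.comp hιm.measurable)
        (g.continuous.measurable.comp hιm.measurable).neg (C := max ‖f‖ ‖g‖)
        (fun x => (f.norm_coe_le_norm (ι x)).trans (le_max_left _ _))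
        (fun y => by
          rw [abs_neg]
          exact (g.norm_coe_le_norm (ι y)).trans (le_max_right _ _))
        (fun x y hxy => by
          have := hfg _ ⟨(x, y), hxy, rfl⟩
          simp only [Prod.map] at this
          linarith)
      rw [integral_neg] at this
      linarith)
  have hrange : ∀ᵐ p ∂ρ, p ∈ range (Prod.map ι ι) := by
    have hae : ∀ α : Measure S, ∀ᵐ y ∂α.map ι, y ∈ range ι :=
      fun α => hιm.ae_map_iff.2 (.of_forall mem_range_self)
    have h₁ : ∀ᵐ p ∂ρ, p.1 ∈ range ι :=
      ae_of_ae_map (p := (· ∈ range ι)) measurable_fst.aemeasurable (hρ₁ ▸ hae μ)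
    have h₂ : ∀ᵐ p ∂ρ, p.2 ∈ range ι :=
      ae_of_ae_map (p := (· ∈ range ι)) measurable_snd.aemeasurable (hρ₂ ▸ hae ν)
    filter_upwards [h₁, h₂] with p hp₁ hp₂
    rw [range_prodMap]
    exact ⟨hp₁, hp₂⟩
  have hmap : (ρ.comap (Prod.map ι ι)).map (Prod.map ι ι) = ρ := by
    rw [hιιm.map_comap, Measure.restrict_eq_self_of_ae_mem hrange]
  set π := ρ.comap (Prod.map ι ι) with hπ
  have hinj : ∀ {α β : Measure S}, α.map ι = β.map ι → α = β := by
    intro α β h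
    rw [← hιm.comap_map α, h, hιm.comap_map]
  refine ⟨π, hinj ?_, hinj ?_, ?_⟩
  · rw [← hρ₁, ← hmap, Measure.map_map hιm.measurable measurable_fst,
      Measure.map_map measurable_fst hιιm.measurable]
    rfl
  · rw [← hρ₂, ← hmap, Measure.map_map hιm.measurable measurable_snd,
      Measure.map_map measurable_snd hιιm.measurable]
    rfl
  · have hpre : Prod.map ι ι ⁻¹' closure R = {p : S × S | p.1 ≤ p.2} := by
      rw [hR, ← hιι.closure_eq_preimage_closure_image, hcl.closure_eq]
    have hρ1 : ρ univ = 1 := by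
      rw [← preimage_univ (f := Prod.fst), ← Measure.map_apply measurable_fst .univ, hρ₁,
        measure_univ]
    rw [← hpre, ← hιιm.map_apply, hmap, ← hρ1]
    exact measure_of_measure_compl_eq_zero hρR

/-- `τ` satisfies the mixture axiom: if `μ = λμ_a + (1−λ)μ_b`, `ν = λν_a + (1−λ)ν_b`
and `μ_a ⪯_sd ν_a`, then `τ(μ, ν) ≥ λ`. -/
theorem tau_mixture_axiom {S : Type*} [TopologicalSpace S] [PolishSpace S]
    [MeasurableSpace S] [BorelSpace S] [PartialOrder S]
    (hcl : IsClosed {p : S × S | p.1 ≤ p.2})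
    (μa μb νa νb : Measure S)
    [IsProbabilityMeasure μa] [IsProbabilityMeasure μb]
    [IsProbabilityMeasure νa] [IsProbabilityMeasure νb]
    (lam : ENNReal) (hlam : lam ≤ 1) (hsd : StochDom μa νa) :
    lam ≤ ⨆ (π : Measure (S × S))
      (_ : π.map Prod.fst = lam • μa + (1 - lam) • μb ∧
           π.map Prod.snd = lam • νa + (1 - lam) • νb),
      π {p : S × S | p.1 ≤ p.2} := by
  obtain ⟨π, hπ₁, hπ₂, hπ⟩ := hsd.exists_coupling hcl
  refine le_iSup₂_of_le (lam • π + (1 - lam) • μb.prod νb) ⟨?_, ?_⟩ ?_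
  · rw [Measure.map_add _ _ measurable_fst, Measure.map_smul, Measure.map_smul, hπ₁,
      Measure.map_fst_prod, measure_univ, one_smul]
  · rw [Measure.map_add _ _ measurable_snd, Measure.map_smul, Measure.map_smul, hπ₂,
      Measure.map_snd_prod, measure_univ, one_smul]
  · simp [hπ]
end
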